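/- arXiv:2207.01655 — 2 statements merged into one kernel-verified Lean document; each statement's English description precedes it below -/
import Mathlib

section
/- There exist k > 1, C > 0 and ε₀ > 0, depending only on N, Λ, α, β, such that for every θ ∈ (0,1) there exists η = η(θ) > 0 with the following property: for every R > 0, every 0 < ε < ε₀R, every ρ > 0, every m, M ∈ ℝ, and every bounded Borel measurable u : ℝ^N → ℝ satisfying L_ε^+ u ≥ −ρ in B_{kR}, u ≤ M in B_{kR}, and |B_R ∩ {u ≤ m}| ≥ θ|B_R|, one has sup_{B_R} u ≤ (1−η)M + ηm + C R² ρ. -/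
open MeasureTheory Metric

/-- The second-order difference `δu(x,y) = u(x+y) + u(x−y) − 2u(x)`. -/
noncomputable def ddiff {N : ℕ} (u : EuclideanSpace ℝ (Fin N) → ℝ)
    (x y : EuclideanSpace ℝ (Fin N)) : ℝ :=
  u (x + y) + u (x - y) - 2 * u x

/-- The maximal Pucci-type operator
`L_ε^+ u(x) = (1/(2ε²))(α·sup_{z ∈ B_Λ} δu(x,εz) + β·⨍_{B_1} δu(x,εy) dy)`. -/
noncomputable def Lplus {N : ℕ} (Λ α β ε : ℝ) (u : EuclideanSpace ℝ (Fin N) → ℝ)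
    (x : EuclideanSpace ℝ (Fin N)) : ℝ :=
  (1 / (2 * ε ^ 2)) *
    (α * sSup ((fun z => ddiff u x (ε • z)) '' ball (0 : EuclideanSpace ℝ (Fin N)) Λ)
      + β * ⨍ y in ball (0 : EuclideanSpace ℝ (Fin N)) 1, ddiff u x (ε • y))

/-- The minimal Pucci-type operator
`L_ε^- u(x) = (1/(2ε²))(α·inf_{z ∈ B_Λ} δu(x,εz) + β·⨍_{B_1} δu(x,εy) dy)`. -/
noncomputable def Lminus {N : ℕ} (Λ α β ε : ℝ) (u : EuclideanSpace ℝ (Fin N) → ℝ)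
    (x : EuclideanSpace ℝ (Fin N)) : ℝ :=
  (1 / (2 * ε ^ 2)) *
    (α * sInf ((fun z => ddiff u x (ε • z)) '' ball (0 : EuclideanSpace ℝ (Fin N)) Λ)
      + β * ⨍ y in ball (0 : EuclideanSpace ℝ (Fin N)) 1, ddiff u x (ε • y))

namespace DeGiorgiOscillation

section
variable {N : ℕ}
local notation "E" => EuclideanSpace ℝ (Fin N)

/-- The uniform probability measure on the unit ball. -/
noncomputable def unif (N : ℕ) : Measure (EuclideanSpace ℝ (Fin N)) :=
  (volume (ball (0 : EuclideanSpace ℝ (Fin N)) 1))⁻¹ • volume.restrict (ball 0 1)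

lemma volume_ball_pos (x : E) {r : ℝ} (hr : 0 < r) : 0 < volume (ball x r) :=
  measure_ball_pos _ _ hr

lemma volume_ball_ne_top (x : E) (r : ℝ) : volume (ball x r) ≠ ⊤ := measure_ball_lt_top.ne

lemma volume_ball_eq (x : E) {r : ℝ} (hr : 0 < r) :
    volume (ball x r) = ENNReal.ofReal (r ^ N) * volume (ball (0 : E) 1) := by
  have := Measure.addHaar_ball_of_pos (volume : Measure E) x hr
  simpa using this

instance : IsProbabilityMeasure (unif N) where
  measure_univ := by
    rw [unif, Measure.smul_apply, Measure.restrict_apply_univ, smul_eq_mul]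
    exact ENNReal.inv_mul_cancel (volume_ball_pos _ one_pos).ne' (volume_ball_ne_top _ _)

lemma setAverage_eq_integral_unif (f : E → ℝ) :
    ⨍ y in ball (0 : E) 1, f y = ∫ y, f y ∂unif N := by
  rw [average, unif, Measure.restrict_apply_univ]

lemma ae_unif_mem_ball : ∀ᵐ y ∂unif N, y ∈ ball (0 : E) 1 := by
  rw [unif]
  exact Measure.ae_smul_measure (ae_restrict_mem measurableSet_ball) _

lemma integral_unif_neg (f : E → ℝ) : ∫ y, f (-y) ∂unif N = ∫ y, f y ∂unif N := by
  rw [unif, integral_smul_measure, integral_smul_measure]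
  congr 1
  rw [← integral_indicator measurableSet_ball, ← integral_indicator measurableSet_ball,
    ← integral_neg_eq_self ((ball (0 : E) 1).indicator f)]
  congr 1
  ext y
  by_cases hy : y ∈ ball (0 : E) 1 <;> simp_all [Set.indicator]

lemma integrable_unif_of_bounded {f : E → ℝ} (hf : Measurable f) {K : ℝ}
    (hK : ∀ y ∈ ball (0 : E) 1, |f y| ≤ K) : Integrable f (unif N) :=
  Integrable.of_bound hf.aestronglyMeasurable K
    (ae_unif_mem_ball.mono fun y hy => by simpa using hK y hy)

lemma integrable_unif_of_continuous {f : E → ℝ} (hf : Continuous f) : Integrable f (unif N) := by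
  obtain ⟨K, hK⟩ := (isCompact_closedBall (0 : E) 1).exists_bound_of_continuousOn hf.continuousOn
  exact integrable_unif_of_bounded hf.measurable fun y hy => hK y (ball_subset_closedBall hy)

lemma volume_preimage_affine (x : E) {r : ℝ} (hr : 0 < r) (S : Set E) :
    ENNReal.ofReal (r ^ N) * volume ((fun y => x + r • y) ⁻¹' S) = volume S := by
  have h1 : (fun y => x + r • y) ⁻¹' S = (fun y => r • y) ⁻¹' ((fun y => x + y) ⁻¹' S) := rfl
  rw [h1, Measure.addHaar_preimage_smul _ hr.ne', measure_preimage_add, ← mul_assoc,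
    ← ENNReal.ofReal_mul (by positivity), finrank_euclideanSpace_fin, abs_of_pos (by positivity),
    mul_inv_cancel₀ (by positivity), ENNReal.ofReal_one, one_mul]

lemma preimage_affine_ball (x : E) {r : ℝ} (hr : 0 < r) (c : E) (s : ℝ) :
    (fun y => x + r • y) ⁻¹' ball (x + r • c) (r * s) = ball c s := by
  ext y
  simp only [Set.mem_preimage, mem_ball, dist_add_left, dist_smul₀, Real.norm_eq_abs, abs_of_pos hr]
  exact mul_lt_mul_iff_right₀ hr

lemma unif_preimage_mul (x : E) {r : ℝ} (hr : 0 < r) (S : Set E) :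
    unif N ((fun y => x + r • y) ⁻¹' S) * volume (ball x r) = volume (S ∩ ball x r) := by
  rw [← volume_preimage_affine x hr (S ∩ ball x r), Set.preimage_inter]
  have h := preimage_affine_ball x hr 0 1
  simp only [smul_zero, add_zero, mul_one] at h
  rw [h, unif, Measure.smul_apply, Measure.restrict_apply' measurableSet_ball, smul_eq_mul,
    volume_ball_eq x hr]
  have h0 := (volume_ball_pos (0 : E) one_pos).ne'
  have h1 := volume_ball_ne_top (0 : E) 1
  calc _ = ((volume (ball (0 : E) 1))⁻¹ * volume (ball (0 : E) 1)) * (ENNReal.ofReal (r ^ N)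
        * volume ((fun y => x + r • y) ⁻¹' S ∩ ball 0 1)) := by ring
    _ = _ := by rw [ENNReal.inv_mul_cancel h0 h1, one_mul]

/-- `v` is a supersolution, up to an error `κ`, of the dynamic programming inequality. -/
def IsSuper (Λ α β ε κ : ℝ) (v : E → ℝ) (Ω : Set E) : Prop :=
  ∀ x ∈ Ω, ∃ z : E, ‖z‖ < Λ ∧
    α * ((v (x + ε • z) + v (x - ε • z)) / 2) + β * ∫ y, v (x + ε • y) ∂unif N ≤ v x + κ

lemma IsSuper.rescale {Λ α β ε κ : ℝ} {v : E → ℝ} {Ω : Set E} (h : IsSuper Λ α β ε κ v Ω)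
    (c : E) {r : ℝ} (hr : 0 < r) :
    IsSuper Λ α β (ε / r) κ (fun x => v (c + r • x)) ((fun x => c + r • x) ⁻¹' Ω) := by
  intro x hx
  obtain ⟨z, hz, h⟩ := h _ hx
  refine ⟨z, hz, ?_⟩
  have e : ∀ y : E, r • ((ε / r) • y) = ε • y := fun y => by
    rw [smul_smul, mul_div_cancel₀ _ hr.ne']
  simpa only [smul_add, smul_sub, e, ← add_assoc, ← add_sub_assoc] using h

lemma IsSuper.div {Λ α β ε κ : ℝ} {v : E → ℝ} {Ω : Set E} (h : IsSuper Λ α β ε κ v Ω)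
    {t : ℝ} (ht : 0 < t) : IsSuper Λ α β ε (κ / t) (fun x => v x / t) Ω := by
  intro x hx
  obtain ⟨z, hz, h⟩ := h _ hx
  refine ⟨z, hz, ?_⟩
  rw [integral_div, ← add_div]
  calc _ = (α * ((v (x + ε • z) + v (x - ε • z)) / 2) + β * ∫ y, v (x + ε • y) ∂unif N) / t := by
        ring
    _ ≤ (v x + κ) / t := div_le_div_of_nonneg_right h ht.le
    _ = _ := add_div _ _ _

/-- Spreading of positivity at scale `ε`. -/
lemma IsSuper.le_of_density {Λ α β ε κ : ℝ} (hα : 0 ≤ α) (hβ : 0 ≤ β) (hε : 0 < ε) {v : E → ℝ}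
    {Ω : Set E} (hv : Measurable v) {K : ℝ} (hK : ∀ x, |v x| ≤ K)
    (h : IsSuper Λ α β ε κ v Ω) {x : E} (hx : x ∈ Ω) {r : ℝ} (hr : ε ≤ r) (hΛ : ε * Λ ≤ r)
    (h0 : ∀ y ∈ ball x r, 0 ≤ v y) {S : Set E} (hS : S ⊆ ball x ε) {s δ : ℝ}
    (hs : 0 ≤ s) (hsS : ∀ y ∈ S, s ≤ v y)
    (hSδ : ENNReal.ofReal δ * volume (ball x ε) ≤ volume S) :
    β * (δ * s) - κ ≤ v x := by
  obtain ⟨z, hz, h⟩ := h x hx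
  have hmem : ∀ z : E, ‖z‖ < Λ → x + ε • z ∈ ball x r := fun z hz => by
    rw [mem_ball, dist_eq_norm, add_sub_cancel_left, norm_smul, Real.norm_eq_abs, abs_of_pos hε]
    exact (mul_lt_mul_of_pos_left hz hε).trans_le hΛ
  have hp := h0 _ (hmem z hz)
  have hm := h0 _ (hmem (-z) (by simpa using hz))
  rw [smul_neg, ← sub_eq_add_neg] at hm
  have hInt : Integrable (fun y => v (x + ε • y)) (unif N) :=
    integrable_unif_of_bounded (by fun_prop) fun y _ => hK _
  have hnn : 0 ≤ᵐ[unif N] fun y => v (x + ε • y) := ae_unif_mem_ball.mono fun y hy => by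
    refine h0 _ ?_
    rw [mem_ball, dist_eq_norm, add_sub_cancel_left, norm_smul, Real.norm_eq_abs, abs_of_pos hε]
    rw [mem_ball_zero_iff] at hy
    nlinarith
  have hmk := mul_meas_ge_le_integral_of_nonneg hnn hInt s
  have hδ' : δ ≤ (unif N).real {y | s ≤ v (x + ε • y)} := by
    rw [measureReal_def, ← ENNReal.ofReal_le_iff_le_toReal (measure_ne_top _ _)]
    refine (ENNReal.mul_le_mul_iff_left (volume_ball_pos x hε).ne' (volume_ball_ne_top x ε)).1 ?_
    refine hSδ.trans ?_
    have := unif_preimage_mul x hε {w | s ≤ v w}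
    rw [Set.preimage_ofPred_eq] at this
    rw [this]
    exact measure_mono fun y hy => ⟨hsS y hy, hS hy⟩
  have : δ * s ≤ ∫ y, v (x + ε • y) ∂unif N := by
    refine le_trans ?_ hmk
    rw [mul_comm]
    gcongr
  have h1 : 0 ≤ α * ((v (x + ε • z) + v (x - ε • z)) / 2) := by positivity
  have h2 := mul_le_mul_of_nonneg_left this hβ
  linarith

lemma ofReal_pow_le_unif {S : Set E} {c : E} {r : ℝ} (hr : 0 < r) (hS : ball c r ⊆ S)
    (hc : ball c r ⊆ ball 0 1) : ENNReal.ofReal (r ^ N) ≤ unif N S := by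
  have h := unif_preimage_mul (0 : E) one_pos S
  simp only [one_smul, zero_add, Set.preimage_id'] at h
  refine (ENNReal.mul_le_mul_iff_left (volume_ball_pos (0 : E) one_pos).ne'
    (volume_ball_ne_top 0 1)).1 ?_
  rw [h, ← volume_ball_eq c hr]
  exact measure_mono (Set.subset_inter hS hc)

lemma le_integral_inner_sq (x : E) :
    (1 / 4) ^ N / 16 * ‖x‖ ^ 2 ≤ ∫ y, (inner ℝ x y) ^ 2 ∂unif N := by
  rcases eq_or_ne x 0 with rfl | hx
  · simp
  have hx' : 0 < ‖x‖ := norm_pos_iff.2 hx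
  have hInt : Integrable (fun y => (inner ℝ x y) ^ 2) (unif N) :=
    integrable_unif_of_continuous (by fun_prop)
  have h := mul_meas_ge_le_integral_of_nonneg (ae_of_all _ fun y => sq_nonneg (inner ℝ x y)) hInt
    (‖x‖ ^ 2 / 16)
  set c : E := (2 * ‖x‖)⁻¹ • x with hc
  have hcn : ‖c‖ = 1 / 2 := by
    rw [hc, norm_smul, norm_inv, norm_mul, norm_norm]
    norm_num
    field_simp
  have h1 : ENNReal.ofReal ((1 / 4) ^ N) ≤ unif N {y | ‖x‖ ^ 2 / 16 ≤ (inner ℝ x y) ^ 2} := by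
    refine ofReal_pow_le_unif (c := c) (by norm_num) (fun y hy => ?_) fun y hy => ?_
    · rw [mem_ball, dist_eq_norm] at hy
      have e1 : inner ℝ x y = ‖x‖ / 2 + inner ℝ x (y - c) := by
        rw [inner_sub_right, hc, inner_smul_right, real_inner_self_eq_norm_sq]
        field_simp
        ring
      have e2 := abs_le.1 (abs_real_inner_le_norm x (y - c))
      have e3 : ‖x‖ / 4 ≤ inner ℝ x y := by nlinarith [e2.1]
      have : (‖x‖ / 4) ^ 2 ≤ (inner ℝ x y) ^ 2 := by gcongr
      simp only [Set.mem_ofPred_eq]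
      linarith
    · rw [mem_ball, dist_eq_norm] at hy
      rw [mem_ball_zero_iff]
      calc ‖y‖ = ‖(y - c) + c‖ := by simp
        _ ≤ ‖y - c‖ + ‖c‖ := norm_add_le _ _
        _ < 1 := by linarith
  have h2 : (1 / 4 : ℝ) ^ N ≤ (unif N).real {y | ‖x‖ ^ 2 / 16 ≤ (inner ℝ x y) ^ 2} := by
    rwa [measureReal_def, ← ENNReal.ofReal_le_iff_le_toReal (measure_ne_top _ _)]
  calc _ = ‖x‖ ^ 2 / 16 * (1 / 4) ^ N := by ring
    _ ≤ _ := by gcongr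
    _ ≤ _ := h

lemma gaussian_symm (γ : ℝ) (x h : E) :
    (Real.exp (-γ * ‖x + h‖ ^ 2) + Real.exp (-γ * ‖x - h‖ ^ 2)) / 2 =
      Real.exp (-γ * ‖x‖ ^ 2) * (Real.exp (-γ * ‖h‖ ^ 2) * Real.cosh (2 * γ * inner ℝ x h)) := by
  have e1 : -γ * ‖x + h‖ ^ 2 = -γ * ‖x‖ ^ 2 + -γ * ‖h‖ ^ 2 + -(2 * γ * inner ℝ x h) := by
    rw [norm_add_sq_real]
    ring
  have e2 : -γ * ‖x - h‖ ^ 2 = -γ * ‖x‖ ^ 2 + -γ * ‖h‖ ^ 2 + 2 * γ * inner ℝ x h := by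
    rw [norm_sub_sq_real]
    ring
  rw [Real.cosh_eq, e1, e2]
  simp only [Real.exp_add]
  ring

lemma le_gaussian_symm (γ : ℝ) (x h : E) :
    Real.exp (-γ * ‖x‖ ^ 2) * (1 - γ * ‖h‖ ^ 2) ≤
      (Real.exp (-γ * ‖x + h‖ ^ 2) + Real.exp (-γ * ‖x - h‖ ^ 2)) / 2 := by
  rw [gaussian_symm]
  gcongr
  calc 1 - γ * ‖h‖ ^ 2 ≤ Real.exp (-γ * ‖h‖ ^ 2) := by
        linarith [Real.add_one_le_exp (-γ * ‖h‖ ^ 2)]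
    _ ≤ _ := le_mul_of_one_le_right (Real.exp_pos _).le (Real.one_le_cosh _)

lemma one_add_sq_div_two_le_cosh (u : ℝ) : 1 + u ^ 2 / 2 ≤ Real.cosh u := by
  have h1 : (u / 2) ^ 2 ≤ Real.sinh (u / 2) ^ 2 := by
    rw [sq_le_sq, Real.abs_sinh]
    exact Real.self_le_sinh_iff.2 (abs_nonneg _)
  have h2 := Real.cosh_two_mul (u / 2)
  rw [Real.cosh_sq, mul_div_cancel₀ u two_ne_zero] at h2
  linarith

lemma le_gaussian_symm_of_small {γ : ℝ} (x h : E) (hh : γ * ‖h‖ ^ 2 ≤ 1 / 2) :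
    Real.exp (-γ * ‖x‖ ^ 2) * (1 - γ * ‖h‖ ^ 2 + γ ^ 2 * (inner ℝ x h) ^ 2) ≤
      (Real.exp (-γ * ‖x + h‖ ^ 2) + Real.exp (-γ * ‖x - h‖ ^ 2)) / 2 := by
  rw [gaussian_symm]
  gcongr
  have h1 : 1 - γ * ‖h‖ ^ 2 ≤ Real.exp (-γ * ‖h‖ ^ 2) := by
    linarith [Real.add_one_le_exp (-γ * ‖h‖ ^ 2)]
  have h2 := one_add_sq_div_two_le_cosh (2 * γ * inner ℝ x h)
  calc _ ≤ (1 - γ * ‖h‖ ^ 2) * (1 + (2 * γ * inner ℝ x h) ^ 2 / 2) := by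
        nlinarith [sq_nonneg (γ * inner ℝ x h)]
    _ ≤ Real.exp (-γ * ‖h‖ ^ 2) * (1 + (2 * γ * inner ℝ x h) ^ 2 / 2) := by gcongr
    _ ≤ _ := by gcongr

lemma integral_unif_symm {f : E → ℝ} (hf : Continuous f) :
    ∫ y, f y ∂unif N = ∫ y, (f y + f (-y)) / 2 ∂unif N := by
  rw [integral_div, integral_add (integrable_unif_of_continuous hf)
    (integrable_unif_of_continuous (by fun_prop)), integral_unif_neg]
  ring

lemma le_integral_gaussian {γ ε : ℝ} (hγ : 0 ≤ γ) (hε : 0 < ε) (hγε : γ * ε ^ 2 ≤ 1 / 2) (x : E) :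
    Real.exp (-γ * ‖x‖ ^ 2) * (1 - γ * ε ^ 2 + γ ^ 2 * ε ^ 2 * ((1 / 4) ^ N / 16 * ‖x‖ ^ 2)) ≤
      ∫ y, Real.exp (-γ * ‖x + ε • y‖ ^ 2) ∂unif N := by
  rw [integral_unif_symm (by fun_prop)]
  have hInt : Integrable (fun y => (inner ℝ x y) ^ 2) (unif N) :=
    integrable_unif_of_continuous (by fun_prop)
  calc _ ≤ Real.exp (-γ * ‖x‖ ^ 2) *
        (1 - γ * ε ^ 2 + γ ^ 2 * ε ^ 2 * ∫ y, (inner ℝ x y) ^ 2 ∂unif N) := by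
        gcongr
        exact le_integral_inner_sq x
    _ = ∫ y, Real.exp (-γ * ‖x‖ ^ 2) *
        (1 - γ * ε ^ 2 + γ ^ 2 * ε ^ 2 * (inner ℝ x y) ^ 2) ∂unif N := by
        rw [integral_const_mul, integral_add (integrable_const _) (hInt.const_mul _),
          integral_const_mul, integral_const]
        simp
    _ ≤ _ := by
        refine integral_mono_ae (integrable_unif_of_continuous (by fun_prop))
          (integrable_unif_of_continuous (by fun_prop)) (ae_unif_mem_ball.mono fun y hy => ?_)
        rw [mem_ball_zero_iff] at hy
        have hy2 : ‖ε • y‖ ^ 2 ≤ ε ^ 2 := by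
          rw [norm_smul, Real.norm_eq_abs, abs_of_pos hε]
          have := norm_nonneg y
          gcongr
          nlinarith
        have := le_gaussian_symm_of_small x (ε • y) (γ := γ) (by nlinarith)
        simp only [smul_neg, ← sub_eq_add_neg]
        refine le_trans ?_ this
        rw [inner_smul_right]
        gcongr Real.exp (-γ * ‖x‖ ^ 2) * ?_
        nlinarith

/-- The test function: a Gaussian bump minus a linear function. -/
noncomputable def bump (b γ : ℝ) (p x : E) : ℝ := b * Real.exp (-γ * ‖x‖ ^ 2) - inner ℝ p x

lemma continuous_bump (b γ : ℝ) (p : E) : Continuous (bump b γ p) := by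
  unfold bump
  fun_prop

lemma bump_operator {α β Λ b γ ε : ℝ} (hα : 0 ≤ α) (hβ : 0 ≤ β) (hαβ : α + β = 1) (hΛ : 1 ≤ Λ)
    (hb : 0 ≤ b) (hγ : 0 ≤ γ) (hε : 0 < ε) (hγε : γ * ε ^ 2 ≤ 1 / 2) (p x : E) {z : E}
    (hz : ‖z‖ < Λ) :
    bump b γ p x + b * Real.exp (-γ * ‖x‖ ^ 2) *
        (ε ^ 2 * (β * (γ ^ 2 * ((1 / 4) ^ N / 16 * ‖x‖ ^ 2)) - γ * Λ ^ 2)) ≤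
      α * ((bump b γ p (x + ε • z) + bump b γ p (x - ε • z)) / 2)
        + β * ∫ y, bump b γ p (x + ε • y) ∂unif N := by
  have hlin : ∫ y, inner ℝ p (x + ε • y) ∂unif N = inner ℝ p x := by
    rw [integral_unif_symm (by fun_prop)]
    have : ∀ y : E, (inner ℝ p (x + ε • y) + inner ℝ p (x + ε • -y)) / 2 = inner ℝ p x := by
      intro y
      simp only [inner_add_right, smul_neg, inner_neg_right]
      ring
    simp only [this, integral_const, probReal_univ, one_smul]
  have hI : ∫ y, bump b γ p (x + ε • y) ∂unif N
      = b * ∫ y, Real.exp (-γ * ‖x + ε • y‖ ^ 2) ∂unif N - inner ℝ p x := by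
    unfold bump
    rw [integral_sub (integrable_unif_of_continuous (by fun_prop))
      (integrable_unif_of_continuous (by fun_prop)), integral_const_mul, hlin]
  have h1 := le_gaussian_symm γ x (ε • z)
  have h2 := le_integral_gaussian hγ hε hγε x
  have hz2 : ‖ε • z‖ ^ 2 ≤ ε ^ 2 * Λ ^ 2 := by
    rw [norm_smul, Real.norm_eq_abs, abs_of_pos hε, mul_pow]
    gcongr
  have h1' : Real.exp (-γ * ‖x‖ ^ 2) * (1 - γ * (ε ^ 2 * Λ ^ 2)) ≤
      (Real.exp (-γ * ‖x + ε • z‖ ^ 2) + Real.exp (-γ * ‖x - ε • z‖ ^ 2)) / 2 := by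
    refine le_trans ?_ h1
    gcongr
  have hΛ2 : 1 ≤ Λ ^ 2 := one_le_pow₀ hΛ
  have h2' : Real.exp (-γ * ‖x‖ ^ 2) *
      (1 - γ * (ε ^ 2 * Λ ^ 2) + γ ^ 2 * ε ^ 2 * ((1 / 4) ^ N / 16 * ‖x‖ ^ 2)) ≤
      ∫ y, Real.exp (-γ * ‖x + ε • y‖ ^ 2) ∂unif N := by
    refine le_trans ?_ h2
    gcongr
    exact le_mul_of_one_le_right (by positivity) hΛ2
  have h3 := add_le_add (mul_le_mul_of_nonneg_left h1' (mul_nonneg hb hα))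
    (mul_le_mul_of_nonneg_left h2' (mul_nonneg hb hβ))
  rw [hI]
  unfold bump
  simp only [inner_add_right, inner_sub_right]
  obtain rfl : α = 1 - β := by linarith
  linear_combination h3

/-- `v - bump b γ p` almost attains its lower bound `c` around `x₀`, up to the height `h` and
outside a set of small relative measure in the ball of radius `ε`. -/
def IsContact (b γ ε h : ℝ) (v : E → ℝ) (p x₀ : E) (c : ℝ) : Prop :=
  c ≤ 0 ∧ (∀ x ∈ ball x₀ ε, c ≤ v x - bump b γ p x) ∧
    volume ({x | c + h ≤ v x - bump b γ p x} ∩ ball x₀ ε) ≤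
      ENNReal.ofReal ((1 / 16) ^ N / 4) * volume (ball x₀ ε)

set_option maxHeartbeats 1000000 in
lemma exists_contact {α β Λ b γ ε κ R : ℝ} (hα : 0 ≤ α) (hβ : 0 < β) (hαβ : α + β = 1)
    (hΛ : 1 ≤ Λ) (hR : 0 ≤ R) (hγ : 2 ≤ γ) (hγβ : 2 * Λ ^ 2 ≤ β * γ * ((1 / 4) ^ N / 16) / 16)
    (hb : b = 4 * Real.exp (γ * R ^ 2)) (hε : 0 < ε) (hεΛ : ε * Λ ≤ 1 / 4)
    (hγε : γ * Λ ^ 2 * ε ^ 2 ≤ 1 / 2)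
    (hκ : κ ≤ b * Real.exp (-γ * (R + 1) ^ 2) * γ * Λ ^ 2 * ε ^ 2 / 4)
    {v : E → ℝ} (hv : Measurable v) {K : ℝ} (hK : ∀ x, |v x| ≤ K)
    (hsup : IsSuper Λ α β ε κ v (ball 0 (R + 2))) (h0 : ∀ x ∈ ball 0 (R + 2), 0 ≤ v x)
    {xs : E} (hxs : xs ∈ ball 0 R) (hxs1 : v xs ≤ 1) {p : E} (hp : ‖p‖ * (R + 2) ≤ 1 / 4) :
    ∃ x₀ ∈ ball (0 : E) (1 / 4), ∃ c,
      IsContact b γ ε (2 * b * γ * Λ ^ 2 / β * (4 * 16 ^ N) * ε ^ 2) v p x₀ c := by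
  have hΛ2 : 1 ≤ Λ ^ 2 := one_le_pow₀ hΛ
  have hγ0 : 0 < γ := by linarith
  have hγε' : γ * ε ^ 2 ≤ 1 / 2 := by
    refine le_trans ?_ hγε
    rw [mul_assoc]
    gcongr
    exact le_mul_of_one_le_left (by positivity) hΛ2
  have hb0 : 0 < b := by rw [hb]; positivity
  set ψ₀ := b * Real.exp (-γ * (R + 1) ^ 2) with hψ₀
  have hψ₀0 : 0 < ψ₀ := by positivity
  have hexp2 : 4 ≤ Real.exp 2 := by
    have := Real.add_one_le_exp (1 : ℝ)
    have h2 : Real.exp 2 = Real.exp 1 * Real.exp 1 := by rw [← Real.exp_add]; norm_num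
    nlinarith
  have hψ₀1 : ψ₀ ≤ 1 := by
    have : ψ₀ = 4 * Real.exp (-(γ * (2 * R + 1))) := by
      rw [hψ₀, hb, mul_assoc, ← Real.exp_add]
      ring_nf
    rw [this, Real.exp_neg]
    have h2 : Real.exp 2 ≤ Real.exp (γ * (2 * R + 1)) := Real.exp_le_exp.2 (by nlinarith)
    rw [← div_eq_mul_inv, div_le_one (by positivity)]
    linarith
  have hψ₀b : ψ₀ ≤ b := by
    refine mul_le_of_le_one_right hb0.le (Real.exp_le_one_iff.2 ?_)
    nlinarith [sq_nonneg (R + 1)]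
  have hinner : ∀ x ∈ ball (0 : E) (R + 2), |inner ℝ p x| ≤ 1 / 4 := fun x hx => by
    rw [mem_ball_zero_iff] at hx
    refine (abs_real_inner_le_norm p x).trans (le_trans ?_ hp)
    gcongr
  set w : E → ℝ := fun x => v x - bump b γ p x with hw
  have hwb : ∀ x ∈ ball (0 : E) (R + 2), -(b + 1 / 4) ≤ w x := fun x hx => by
    have h1 := abs_le.1 (hinner x hx)
    have h2 := h0 x hx
    have h3 : b * Real.exp (-γ * ‖x‖ ^ 2) ≤ b :=
      mul_le_of_le_one_right hb0.le (Real.exp_le_one_iff.2 (by nlinarith [sq_nonneg ‖x‖]))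
    simp only [hw, bump]
    linarith
  have hbdd : BddBelow (w '' ball (0 : E) (R + 2)) :=
    ⟨-(b + 1 / 4), by rintro _ ⟨x, hx, rfl⟩; exact hwb x hx⟩
  set c := sInf (w '' ball (0 : E) (R + 2)) with hc
  have hcw : ∀ x ∈ ball (0 : E) (R + 2), c ≤ w x := fun x hx =>
    csInf_le hbdd (Set.mem_image_of_mem _ hx)
  have hxs2 : xs ∈ ball (0 : E) (R + 2) := ball_subset_ball (by linarith) hxs
  have hc1 : c ≤ -11 / 4 := by
    refine (hcw xs hxs2).trans ?_
    have h1 := abs_le.1 (hinner xs hxs2)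
    have h3 : 4 ≤ b * Real.exp (-γ * ‖xs‖ ^ 2) := by
      rw [hb, mul_assoc, ← Real.exp_add]
      have : 1 ≤ Real.exp (γ * R ^ 2 + -γ * ‖xs‖ ^ 2) := by
        rw [Real.one_le_exp_iff]
        rw [mem_ball_zero_iff] at hxs
        have : ‖xs‖ ^ 2 ≤ R ^ 2 := by gcongr
        nlinarith
      linarith
    simp only [hw, bump]
    linarith
  set τ := ψ₀ * γ * Λ ^ 2 * ε ^ 2 / 4 with hτ
  have hτ0 : 0 < τ := by positivity
  have hτ1 : τ ≤ 1 / 8 := by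
    have : ψ₀ * (γ * Λ ^ 2 * ε ^ 2) ≤ 1 * (1 / 2) := by gcongr
    rw [hτ]
    linarith
  obtain ⟨_, ⟨x₀, hx₀, rfl⟩, hx₀c⟩ := exists_lt_of_csInf_lt
    (Set.Nonempty.image w ⟨xs, hxs2⟩) (show c < c + τ by linarith)
  have hx₀R : ‖x₀‖ < R + 1 := by
    by_contra! hge
    have h1 := abs_le.1 (hinner x₀ hx₀)
    have h2 := h0 x₀ hx₀
    have h3 : b * Real.exp (-γ * ‖x₀‖ ^ 2) ≤ ψ₀ := by
      rw [hψ₀]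
      have : (R + 1) ^ 2 ≤ ‖x₀‖ ^ 2 := by gcongr
      gcongr b * Real.exp ?_
      nlinarith
    simp only [hw, bump] at hx₀c
    linarith
  have hnear : ∀ y : E, ‖y‖ < Λ → x₀ + ε • y ∈ ball (0 : E) (R + 2) := fun y hy => by
    rw [mem_ball_zero_iff]
    refine (norm_add_le _ _).trans_lt ?_
    rw [norm_smul, Real.norm_eq_abs, abs_of_pos hε]
    nlinarith
  obtain ⟨z, hz, hs⟩ := hsup x₀ hx₀
  have hop := bump_operator hα hβ.le hαβ hΛ hb0.le hγ0.le hε hγε' p x₀ hz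
  have hp1 := hcw _ (hnear z hz)
  have hp2 := hcw _ (hnear (-z) (by simpa using hz))
  rw [smul_neg, ← sub_eq_add_neg] at hp2
  have hintv : Integrable (fun y => v (x₀ + ε • y)) (unif N) :=
    integrable_unif_of_bounded (by fun_prop) fun y _ => hK _
  have hintb : Integrable (fun y => bump b γ p (x₀ + ε • y)) (unif N) :=
    integrable_unif_of_continuous ((continuous_bump b γ p).comp (by fun_prop))
  have hintw : Integrable (fun y => w (x₀ + ε • y) - c) (unif N) :=
    (hintv.sub hintb).sub (integrable_const c)
  have hI : ∫ y, (w (x₀ + ε • y) - c) ∂unif N =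
      ∫ y, v (x₀ + ε • y) ∂unif N - ∫ y, bump b γ p (x₀ + ε • y) ∂unif N - c := by
    have e : ∫ y, (w (x₀ + ε • y) - c) ∂unif N =
        ∫ y, (v (x₀ + ε • y) - bump b γ p (x₀ + ε • y)) ∂unif N - ∫ _, c ∂unif N :=
      integral_sub (hintv.sub hintb) (integrable_const c)
    rw [e, integral_sub hintv hintb, integral_const, probReal_univ, one_smul]
  have hnn : 0 ≤ᵐ[unif N] fun y => w (x₀ + ε • y) - c := ae_unif_mem_ball.mono fun y hy => by
    rw [mem_ball_zero_iff] at hy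
    exact sub_nonneg.2 (hcw _ (hnear y (hy.trans_le hΛ)))
  have hInn := integral_nonneg_of_ae hnn
  set I := ∫ y, (w (x₀ + ε • y) - c) ∂unif N with hIdef
  have hmain : b * Real.exp (-γ * ‖x₀‖ ^ 2) *
        (ε ^ 2 * (β * (γ ^ 2 * ((1 / 4) ^ N / 16 * ‖x₀‖ ^ 2)) - γ * Λ ^ 2)) + β * I ≤ τ + κ := by
    have h1 : α * (c + c) ≤ α * (w (x₀ + ε • z) + w (x₀ - ε • z)) := by gcongr
    simp only [hw] at h1 hx₀c
    rw [hI]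
    obtain rfl : α = 1 - β := by linarith
    linear_combination hop + hs + hx₀c + h1 / 2
  have hβI : 0 ≤ β * I := by positivity
  have hx₀4 : ‖x₀‖ < 1 / 4 := by
    by_contra! hge
    have h1 : (1 / 4) ^ 2 ≤ ‖x₀‖ ^ 2 := by gcongr
    have h2 : ψ₀ ≤ b * Real.exp (-γ * ‖x₀‖ ^ 2) := by
      rw [hψ₀]
      have : ‖x₀‖ ^ 2 ≤ (R + 1) ^ 2 := by gcongr
      gcongr b * Real.exp ?_
      nlinarith
    have h3 : γ * Λ ^ 2 ≤ β * (γ ^ 2 * ((1 / 4) ^ N / 16 * ‖x₀‖ ^ 2)) - γ * Λ ^ 2 := by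
      have : γ * (2 * Λ ^ 2) ≤ γ * (β * γ * ((1 / 4) ^ N / 16) / 16) := by gcongr
      have : β * (γ ^ 2 * ((1 / 4) ^ N / 16 * (1 / 4) ^ 2)) ≤
        β * (γ ^ 2 * ((1 / 4) ^ N / 16 * ‖x₀‖ ^ 2)) := by gcongr
      linarith
    have h4 : ψ₀ * (ε ^ 2 * (γ * Λ ^ 2)) ≤ b * Real.exp (-γ * ‖x₀‖ ^ 2) *
        (ε ^ 2 * (β * (γ ^ 2 * ((1 / 4) ^ N / 16 * ‖x₀‖ ^ 2)) - γ * Λ ^ 2)) := by gcongr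
    linarith
  have hI1 : β * I ≤ 2 * b * γ * Λ ^ 2 * ε ^ 2 := by
    have h1 : b * Real.exp (-γ * ‖x₀‖ ^ 2) ≤ b :=
      mul_le_of_le_one_right hb0.le (Real.exp_le_one_iff.2 (by nlinarith [sq_nonneg ‖x₀‖]))
    have h2 : b * Real.exp (-γ * ‖x₀‖ ^ 2) * (ε ^ 2 * (γ * Λ ^ 2)) ≤ b * (ε ^ 2 * (γ * Λ ^ 2)) := by
      gcongr
    have h3 : 0 ≤ b * Real.exp (-γ * ‖x₀‖ ^ 2) *
        (ε ^ 2 * (β * (γ ^ 2 * ((1 / 4) ^ N / 16 * ‖x₀‖ ^ 2)))) := by positivity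
    have h4 : ψ₀ * (γ * Λ ^ 2 * ε ^ 2) ≤ b * (γ * Λ ^ 2 * ε ^ 2) := by gcongr
    linarith
  have hI2 : I ≤ 2 * b * γ * Λ ^ 2 / β * ε ^ 2 := by
    rw [div_mul_eq_mul_div, le_div_iff₀ hβ]
    linarith
  refine ⟨x₀, mem_ball_zero_iff.2 hx₀4, c, by linarith, fun x hx => hcw x ?_, ?_⟩
  · rw [mem_ball, dist_eq_norm] at hx
    rw [mem_ball_zero_iff]
    calc ‖x‖ = ‖(x - x₀) + x₀‖ := by simp
      _ ≤ _ := norm_add_le _ _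
      _ < _ := by nlinarith
  · rw [← unif_preimage_mul x₀ hε]
    gcongr
    have hmk := mul_meas_ge_le_integral_of_nonneg hnn hintw
      (2 * b * γ * Λ ^ 2 / β * (4 * 16 ^ N) * ε ^ 2)
    rw [← hIdef] at hmk
    have hset : (fun y => x₀ + ε • y) ⁻¹' {x | c + 2 * b * γ * Λ ^ 2 / β * (4 * 16 ^ N) * ε ^ 2 ≤
        v x - bump b γ p x} =
        {y | 2 * b * γ * Λ ^ 2 / β * (4 * 16 ^ N) * ε ^ 2 ≤ w (x₀ + ε • y) - c} := by
      ext y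
      simp only [Set.mem_preimage, Set.mem_ofPred_eq, hw]
      constructor <;> intro h <;> linarith
    rw [hset]
    refine (ENNReal.le_ofReal_iff_toReal_le (measure_ne_top _ _) (by positivity)).2 ?_
    change (unif N).real _ ≤ _
    set A := 2 * b * γ * Λ ^ 2 / β * ε ^ 2 with hA
    have hA0 : 0 < A := by positivity
    have e1 : 2 * b * γ * Λ ^ 2 / β * (4 * 16 ^ N) * ε ^ 2 = A * (4 * 16 ^ N) := by rw [hA]; ring
    rw [e1] at hmk ⊢
    have e2 : ((1 : ℝ) / 16) ^ N / 4 = 1 / (4 * 16 ^ N) := by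
      rw [div_pow, one_pow]; field_simp
    rw [e2, le_div_iff₀ (by positivity)]
    have := hmk.trans hI2
    rw [mul_assoc] at this
    have := (mul_le_iff_le_one_right hA0).1 this
    linarith

lemma IsContact.norm_sub_le {b γ ε h : ℝ} (hε : 0 < ε) {v : E → ℝ}
    {p q x₀ x₁ : E} {c c' : ℝ} (hp : IsContact b γ ε h v p x₀ c)
    (hq : IsContact b γ ε h v q x₁ c') (hd : dist x₀ x₁ ≤ ε / 4) : ‖p - q‖ ≤ 8 * (h / ε) := by
  obtain ⟨-, hp1, hp2⟩ := hp
  obtain ⟨-, hq1, hq2⟩ := hq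
  rcases eq_or_ne p q with rfl | hne
  · have : 0 ≤ h := by
      by_contra! hneg
      have hsub : ball x₀ ε ⊆ {x | c + h ≤ v x - bump b γ p x} ∩ ball x₀ ε := fun x hx =>
        ⟨by simp only [Set.mem_ofPred_eq]; linarith [hp1 x hx], hx⟩
      have h1 := (measure_mono hsub).trans hp2
      have h2 : ENNReal.ofReal ((1 / 16) ^ N / 4) < 1 := by
        rw [ENNReal.ofReal_lt_one]
        have : ((1 : ℝ) / 16) ^ N ≤ 1 := pow_le_one₀ (by norm_num) (by norm_num)
        linarith
      have h3 := ENNReal.mul_lt_mul_left (volume_ball_pos x₀ hε).ne' (volume_ball_ne_top x₀ ε) h2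
      rw [one_mul] at h3
      exact absurd h1 (not_le.2 h3)
    rw [sub_self, norm_zero]
    positivity
  set d := p - q with hdd
  have hd0 : 0 < ‖d‖ := norm_pos_iff.2 (sub_ne_zero.2 hne)
  have key : ∀ s : ℝ, |s| = ε / 4 → ∃ x : E, (∃ r : E, x = x₁ + (s / ‖d‖) • d + r ∧ ‖r‖ < ε / 8) ∧
      c ≤ v x - bump b γ p x ∧ v x - bump b γ p x ≤ c + h ∧
      c' ≤ v x - bump b γ q x ∧ v x - bump b γ q x ≤ c' + h := by
    intro s hs
    set y := x₁ + (s / ‖d‖) • d with hy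
    have hy1 : ‖(s / ‖d‖) • d‖ = ε / 4 := by
      rw [norm_smul, norm_div, norm_norm, Real.norm_eq_abs, hs]
      field_simp
    have hsub1 : ball y (ε / 8) ⊆ ball x₁ ε := ball_subset_ball' (by
      rw [dist_eq_norm, hy, add_sub_cancel_left, hy1]; linarith)
    have hsub0 : ball y (ε / 8) ⊆ ball x₀ ε := ball_subset_ball' (by
      have := dist_triangle y x₁ x₀
      rw [dist_eq_norm y x₁, hy, add_sub_cancel_left, hy1, dist_comm x₁] at this
      linarith)
    have hlt : volume (({x | c + h ≤ v x - bump b γ p x} ∩ ball x₀ ε) ∪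
        ({x | c' + h ≤ v x - bump b γ q x} ∩ ball x₁ ε)) < volume (ball y (ε / 8)) := by
      refine (measure_union_le _ _).trans_lt ((add_le_add hp2 hq2).trans_lt ?_)
      rw [volume_ball_eq x₀ hε, volume_ball_eq x₁ hε, volume_ball_eq y (by positivity), ← add_mul,
        ← mul_assoc, ← ENNReal.ofReal_add (by positivity) (by positivity),
        ← ENNReal.ofReal_mul (by positivity)]
      refine ENNReal.mul_lt_mul_left (volume_ball_pos _ one_pos).ne' (volume_ball_ne_top _ _) ?_
      refine (ENNReal.ofReal_lt_ofReal_iff (by positivity)).2 ?_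
      have h1 : ((1 : ℝ) / 16) ^ N ≤ (1 / 8) ^ N := by gcongr; norm_num
      have h2 : (ε / 8) ^ N = (1 / 8) ^ N * ε ^ N := by rw [← mul_pow]; ring
      have h3 : 0 < ε ^ N := by positivity
      have h4 : ((1 : ℝ) / 16) ^ N * ε ^ N ≤ (1 / 8) ^ N * ε ^ N := by gcongr
      have h5 : 0 < (1 / 8 : ℝ) ^ N * ε ^ N := by positivity
      rw [h2]
      linarith
    have hex : (ball y (ε / 8) \ (({x | c + h ≤ v x - bump b γ p x} ∩ ball x₀ ε) ∪
        ({x | c' + h ≤ v x - bump b γ q x} ∩ ball x₁ ε))).Nonempty := by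
      by_contra! hemp
      exact absurd (measure_mono (Set.sdiff_eq_empty.1 hemp)) (not_le.2 hlt)
    obtain ⟨x, hx, hxn⟩ := hex
    have hx0 := hsub0 hx
    have hx1 := hsub1 hx
    simp only [Set.mem_union, Set.mem_inter_iff, hx0, hx1, and_true, not_or, Set.mem_ofPred_eq,
      not_le] at hxn
    refine ⟨x, ⟨x - y, by abel, by rwa [mem_ball, dist_eq_norm] at hx⟩, hp1 x hx0, hxn.1.le,
      hq1 x hx1, hxn.2.le⟩
  obtain ⟨x, ⟨r, rfl, hr⟩, h1, h2, h3, h4⟩ := key (ε / 4) (abs_of_pos (by positivity))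
  obtain ⟨x', ⟨r', rfl, hr'⟩, h1', h2', h3', h4'⟩ := key (-(ε / 4))
    (by rw [abs_neg]; exact abs_of_pos (by positivity))
  have hsub : ∀ x, (v x - bump b γ p x) - (v x - bump b γ q x) = inner ℝ d x := fun x => by
    simp only [bump, hdd, inner_sub_left]
    ring
  have e1 := hsub (x₁ + (ε / 4 / ‖d‖) • d + r)
  have e2 := hsub (x₁ + (-(ε / 4) / ‖d‖) • d + r')
  rw [inner_add_right, inner_add_right, inner_smul_right, real_inner_self_eq_norm_sq] at e1 e2
  have f1 : ε / 4 / ‖d‖ * ‖d‖ ^ 2 = ε / 4 * ‖d‖ := by field_simp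
  have f2 : -(ε / 4) / ‖d‖ * ‖d‖ ^ 2 = -(ε / 4) * ‖d‖ := by field_simp
  rw [f1] at e1
  rw [f2] at e2
  have g1 := (abs_le.1 (abs_real_inner_le_norm d r)).1
  have g2 := (abs_le.1 (abs_real_inner_le_norm d r')).2
  have k1 : ‖d‖ * ‖r‖ ≤ ‖d‖ * (ε / 8) := by gcongr
  have k2 : ‖d‖ * ‖r'‖ ≤ ‖d‖ * (ε / 8) := by gcongr
  rw [mul_div_assoc', le_div_iff₀ hε]
  linarith

/-- Small values of a nonnegative supersolution on a ball force a lower bound on the measure of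
one of its sublevel sets. -/
def MeasureEstimate (N : ℕ) (Λ α β R K c σ ε₁ : ℝ) : Prop :=
  ∀ ε κ : ℝ, 0 < ε → ε ≤ ε₁ → κ ≤ σ * ε ^ 2 → ∀ v : EuclideanSpace ℝ (Fin N) → ℝ,
    Measurable v → (∃ K, ∀ x, |v x| ≤ K) → IsSuper Λ α β ε κ v (ball 0 (R + 2)) →
    (∀ x ∈ ball 0 (R + 2), 0 ≤ v x) → (∃ x ∈ ball 0 R, v x ≤ 1) →
    ENNReal.ofReal c ≤ volume ({x | v x ≤ K} ∩ ball 0 (1 / 2))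

lemma measure_estimate (N : ℕ) {α β Λ R : ℝ} (hα : 0 ≤ α) (hβ : 0 < β) (hαβ : α + β = 1)
    (hΛ : 1 ≤ Λ) (hR : 0 ≤ R) : ∃ K c σ ε₁ : ℝ, 1 ≤ K ∧ 0 < c ∧ 0 < σ ∧ 0 < ε₁ ∧
      ε₁ * Λ ≤ 1 / 4 ∧
      MeasureEstimate N Λ α β R K c σ ε₁ := by
  have hβ1 : β ≤ 1 := by linarith
  have hΛ0 : 0 < Λ := by linarith
  have hΛ2 : 1 ≤ Λ ^ 2 := one_le_pow₀ hΛ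
  set γ : ℝ := 512 * Λ ^ 2 * 4 ^ N / β with hγdef
  have h4N : (1 : ℝ) ≤ 4 ^ N := one_le_pow₀ (by norm_num)
  have hγ : 2 ≤ γ := by
    rw [hγdef, le_div_iff₀ hβ]
    have : 1 * 1 ≤ Λ ^ 2 * 4 ^ N := mul_le_mul hΛ2 h4N zero_le_one (by positivity)
    linarith
  have hγβ : 2 * Λ ^ 2 ≤ β * γ * ((1 / 4) ^ N / 16) / 16 := by
    rw [hγdef, div_pow, one_pow]
    apply le_of_eq
    field_simp
    norm_num
  set b : ℝ := 4 * Real.exp (γ * R ^ 2) with hb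
  have hb0 : 0 < b := by positivity
  set H : ℝ := 2 * b * γ * Λ ^ 2 / β * (4 * 16 ^ N) with hH
  have hH0 : 0 < H := by positivity
  set a : ℝ := 1 / (4 * (R + 2)) with ha
  have ha0 : 0 < a := by positivity
  set V : ℝ := (volume (ball (0 : EuclideanSpace ℝ (Fin N)) 1)).toReal with hV
  have hV0 : 0 < V := ENNReal.toReal_pos (volume_ball_pos _ one_pos).ne' (volume_ball_ne_top _ _)
  have hVV : volume (ball (0 : EuclideanSpace ℝ (Fin N)) 1) = ENNReal.ofReal V :=
    (ENNReal.ofReal_toReal (volume_ball_ne_top _ _)).symm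
  refine ⟨b + 1 / 4 + H, a ^ N * V / ((128 * H) ^ N * (4 / 3)),
    b * Real.exp (-γ * (R + 1) ^ 2) * γ * Λ ^ 2 / 4, 1 / (4 * γ * Λ ^ 2), ?_, by positivity,
    by positivity, by positivity, ?_, ?_⟩
  · have : 1 ≤ Real.exp (γ * R ^ 2) := Real.one_le_exp (by positivity)
    linarith
  · rw [div_mul_eq_mul_div, div_le_iff₀ (by positivity)]
    nlinarith
  intro ε κ hε hε₁ hκ v hv ⟨K', hK'⟩ hsup h0 ⟨xs, hxs, hxs1⟩
  rw [le_div_iff₀ (by positivity)] at hε₁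
  have hεΛ : ε * Λ ≤ 1 / 4 := by
    have : ε * Λ * 1 ≤ ε * Λ * (γ * Λ) := by gcongr; nlinarith
    linarith
  have hε4 : ε ≤ 1 / 4 := by nlinarith
  have hγε : γ * Λ ^ 2 * ε ^ 2 ≤ 1 / 2 := by nlinarith
  have hex : ∀ p : EuclideanSpace ℝ (Fin N), ∃ x₀ c, p ∈ closedBall (0 : EuclideanSpace ℝ (Fin N)) a →
      x₀ ∈ ball (0 : EuclideanSpace ℝ (Fin N)) (1 / 4) ∧ IsContact b γ ε (H * ε ^ 2) v p x₀ c := by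
    intro p
    by_cases hp : p ∈ closedBall (0 : EuclideanSpace ℝ (Fin N)) a
    · rw [mem_closedBall_zero_iff, ha, le_div_iff₀ (by positivity)] at hp
      obtain ⟨x₀, hx₀, c, hc⟩ := exists_contact hα hβ hαβ hΛ hR hγ hγβ hb hε hεΛ hγε
        (κ := κ) (by linarith) hv hK' hsup h0 hxs hxs1 (p := p) (by linarith)
      exact ⟨x₀, c, fun _ => ⟨hx₀, hc⟩⟩
    · exact ⟨0, 0, fun h => absurd h hp⟩
  choose x c hxc using hex
  obtain ⟨u, hut, hud, hu⟩ := Vitali.exists_disjoint_subfamily_covering_enlargement_closedBall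
    (closedBall (0 : EuclideanSpace ℝ (Fin N)) a) x (fun _ => ε / 16) (ε / 16) (fun _ _ => le_rfl)
    4 (by norm_num)
  have hud' : u.PairwiseDisjoint fun p => ball (x p) (ε / 16) :=
    hud.mono fun _ => ball_subset_closedBall
  have huc : u.Countable := hud'.countable_of_isOpen (fun _ _ => isOpen_ball)
    fun _ _ => nonempty_ball.2 (by positivity)
  set S : Set (EuclideanSpace ℝ (Fin N)) := {y | v y ≤ b + 1 / 4 + H} with hS
  have hSm : MeasurableSet S := measurableSet_le hv measurable_const
  have hcover : closedBall (0 : EuclideanSpace ℝ (Fin N)) a ⊆ ⋃ p ∈ u, closedBall p (8 * H * ε) := by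
    intro p hp
    obtain ⟨q, hq, hpq⟩ := hu p hp
    have hd : dist (x p) (x q) ≤ ε / 4 := by
      have := hpq (mem_closedBall_self (by positivity))
      rw [mem_closedBall] at this
      linarith
    have := (hxc p hp).2.norm_sub_le hε (hxc q (hut hq)).2 hd
    refine Set.mem_iUnion₂.2 ⟨q, hq, ?_⟩
    rw [mem_closedBall, dist_eq_norm]
    refine this.trans (le_of_eq ?_)
    field_simp
  have hdens : ∀ p ∈ u, volume (ball (x p) (ε / 16)) ≤
      ENNReal.ofReal (4 / 3) * volume (S ∩ ball (x p) (ε / 16)) := by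
    intro p hp
    obtain ⟨hx4, hc0, hc1, hc2⟩ := hxc p (hut hp)
    have hsub : ball (x p) (ε / 16) ⊆ (S ∩ ball (x p) (ε / 16)) ∪
        ({y | c p + H * ε ^ 2 ≤ v y - bump b γ p y} ∩ ball (x p) ε) := by
      intro y hy
      by_cases hyb : c p + H * ε ^ 2 ≤ v y - bump b γ p y
      · exact Or.inr ⟨hyb, ball_subset_ball (by linarith) hy⟩
      · refine Or.inl ⟨?_, hy⟩
        have hpn := mem_closedBall_zero_iff.1 (hut hp)
        rw [ha, le_div_iff₀ (by positivity)] at hpn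
        have hyn : ‖y‖ ≤ R + 2 := by
          rw [mem_ball, dist_eq_norm] at hy
          rw [mem_ball_zero_iff] at hx4
          have := norm_add_le (y - x p) (x p)
          rw [sub_add_cancel] at this
          linarith
        have h1 := (abs_le.1 (abs_real_inner_le_norm p y)).1
        have h2 : ‖p‖ * ‖y‖ ≤ ‖p‖ * (R + 2) := by gcongr
        have h3 : b * Real.exp (-γ * ‖y‖ ^ 2) ≤ b :=
          mul_le_of_le_one_right hb0.le (Real.exp_le_one_iff.2 (by nlinarith [sq_nonneg ‖y‖]))
        have h4 : H * ε ^ 2 ≤ H := mul_le_of_le_one_right hH0.le (by nlinarith)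
        simp only [bump] at hyb
        change v y ≤ _
        linarith
    have h1 := (measure_mono hsub).trans ((measure_union_le _ _).trans
      (add_le_add_right hc2 (volume (S ∩ ball (x p) (ε / 16)))))
    have h2 : ENNReal.ofReal ((1 / 16) ^ N / 4) * volume (ball (x p) ε) =
        ENNReal.ofReal (1 / 4) * volume (ball (x p) (ε / 16)) := by
      rw [volume_ball_eq _ hε, volume_ball_eq _ (show 0 < ε / 16 by positivity), ← mul_assoc,
        ← mul_assoc, ← ENNReal.ofReal_mul (by positivity), ← ENNReal.ofReal_mul (by positivity)]
      congr 2
      rw [div_pow, div_pow, one_pow]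
      ring
    rw [h2] at h1
    have hfin := volume_ball_ne_top (x p) (ε / 16)
    have hfin' : volume (S ∩ ball (x p) (ε / 16)) ≠ ⊤ := measure_ne_top_of_subset
      Set.inter_subset_right hfin
    rw [← ENNReal.toReal_le_toReal hfin (ENNReal.mul_ne_top ENNReal.ofReal_ne_top hfin'),
      ENNReal.toReal_mul, ENNReal.toReal_ofReal (by norm_num)]
    rw [← ENNReal.toReal_le_toReal hfin (ENNReal.add_ne_top.2
      ⟨hfin', ENNReal.mul_ne_top ENNReal.ofReal_ne_top hfin⟩), ENNReal.toReal_add hfin'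
      (ENNReal.mul_ne_top ENNReal.ofReal_ne_top hfin), ENNReal.toReal_mul,
      ENNReal.toReal_ofReal (by norm_num)] at h1
    linarith
  have hball : ∀ p ∈ u, volume (closedBall p (8 * H * ε)) ≤
      ENNReal.ofReal ((128 * H) ^ N * (4 / 3)) * volume (S ∩ ball (x p) (ε / 16)) := by
    intro p hp
    have e := Measure.addHaar_closedBall (volume : Measure (EuclideanSpace ℝ (Fin N))) p
      (show 0 ≤ 8 * H * ε by positivity)
    rw [finrank_euclideanSpace_fin] at e
    have e2 : ENNReal.ofReal ((8 * H * ε) ^ N) * volume (ball (0 : EuclideanSpace ℝ (Fin N)) 1) =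
        ENNReal.ofReal ((128 * H) ^ N) * volume (ball (x p) (ε / 16)) := by
      rw [volume_ball_eq _ (show 0 < ε / 16 by positivity),
        ← mul_assoc (ENNReal.ofReal ((128 * H) ^ N)), ← ENNReal.ofReal_mul (by positivity), ← mul_pow]
      congr 3
      ring
    rw [e, e2, ENNReal.ofReal_mul (by positivity), mul_assoc]
    gcongr
    exact hdens p hp
  have hfinal : ENNReal.ofReal (a ^ N * V) ≤ ENNReal.ofReal ((128 * H) ^ N * (4 / 3)) *
      volume (S ∩ ball (0 : EuclideanSpace ℝ (Fin N)) (1 / 2)) := by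
    calc ENNReal.ofReal (a ^ N * V) = volume (ball (0 : EuclideanSpace ℝ (Fin N)) a) := by
          rw [volume_ball_eq _ ha0, hVV, ENNReal.ofReal_mul (by positivity)]
      _ ≤ volume (⋃ p ∈ u, closedBall p (8 * H * ε)) :=
          measure_mono (ball_subset_closedBall.trans hcover)
      _ ≤ ∑' p : u, volume (closedBall (p : EuclideanSpace ℝ (Fin N)) (8 * H * ε)) :=
          measure_biUnion_le _ huc _
      _ ≤ ∑' p : u, ENNReal.ofReal ((128 * H) ^ N * (4 / 3)) *
            volume (S ∩ ball (x p) (ε / 16)) := ENNReal.tsum_le_tsum fun p => hball p p.2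
      _ = ENNReal.ofReal ((128 * H) ^ N * (4 / 3)) *
            volume (⋃ p ∈ u, S ∩ ball (x p) (ε / 16)) := by
          rw [ENNReal.tsum_mul_left, measure_biUnion huc
            (hud'.mono fun _ => Set.inter_subset_right)
            fun _ _ => hSm.inter measurableSet_ball]
      _ ≤ _ := by
          gcongr
          refine Set.iUnion₂_subset fun p hp => Set.inter_subset_inter_right _
            (ball_subset_ball' ?_)
          have := mem_ball.1 (hxc p (hut hp)).1
          linarith
  rw [ENNReal.ofReal_div_of_pos (by positivity)]
  exact ENNReal.div_le_of_le_mul' hfinal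

lemma measure_estimate_scaled {α β Λ R K c σ ε₁ : ℝ}
    (hest : MeasureEstimate N Λ α β R K c σ ε₁)
    {ε κ r t : ℝ} (hr : 0 < r) (ht : 0 < t) (hε : 0 < ε) (hε₁ : ε ≤ ε₁ * r)
    (hκ : κ ≤ σ * t * (ε / r) ^ 2) {v : E → ℝ} (hv : Measurable v) (hvb : ∃ K, ∀ x, |v x| ≤ K)
    {a : E} (hsup : IsSuper Λ α β ε κ v (ball a (r * (R + 2))))
    (h0 : ∀ x ∈ ball a (r * (R + 2)), 0 ≤ v x) (hx : ∃ x ∈ ball a (r * R), v x ≤ t) :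
    ENNReal.ofReal (r ^ N) * ENNReal.ofReal c ≤
      volume ({x | v x ≤ K * t} ∩ ball a (r * (1 / 2))) := by
  have hpre : ∀ s, (fun y : E => a + r • y) ⁻¹' ball a (r * s) = ball 0 s := fun s => by
    simpa using preimage_affine_ball a hr 0 s
  obtain ⟨M, hM⟩ := hvb
  have h := hest (ε / r) (κ / t) (by positivity) (by rwa [div_le_iff₀ hr])
    (by rw [div_le_iff₀ ht]; linarith) (fun x => v (a + r • x) / t) (by fun_prop)
    ⟨M / t, fun x => by rw [abs_div, abs_of_pos ht]; exact div_le_div_of_nonneg_right (hM _) ht.le⟩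
    (by
      have := (hsup.rescale a hr).div ht
      rwa [hpre] at this)
    (fun x hx => by
      rw [← hpre] at hx
      exact div_nonneg (h0 _ hx) ht.le)
    (by
      obtain ⟨x, hx, hxt⟩ := hx
      have e : a + r • (r⁻¹ • (x - a)) = x := by
        rw [smul_smul, mul_inv_cancel₀ hr.ne', one_smul, add_sub_cancel]
      refine ⟨r⁻¹ • (x - a), ?_, ?_⟩
      · rw [← hpre, Set.mem_preimage, e]
        exact hx
      · rw [e]
        exact (div_le_one ht).2 hxt)
  rw [← volume_preimage_affine a hr, Set.preimage_inter, hpre]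
  gcongr
  refine h.trans (measure_mono (Set.inter_subset_inter_left _ fun x hx => ?_))
  exact (div_le_iff₀ ht).1 hx

lemma measure_preimage_le {X ι : Type*} [MeasurableSpace X] [Countable ι] [MeasurableSpace ι]
    [MeasurableSingletonClass ι] {f : X → ι} (hf : Measurable f) {ν₁ ν₂ : Measure X} {S : Set ι}
    (h : ∀ k ∈ S, ν₁ (f ⁻¹' {k}) ≤ ν₂ (f ⁻¹' {k})) : ν₁ (f ⁻¹' S) ≤ ν₂ (f ⁻¹' S) := by
  rw [← tsum_measure_preimage_singleton S.to_countable fun k _ => hf (measurableSet_singleton k),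
    ← tsum_measure_preimage_singleton S.to_countable fun k _ => hf (measurableSet_singleton k)]
  exact ENNReal.tsum_le_tsum fun k => h k k.2

/-- A Calderón–Zygmund covering lemma for a finite tree of partitions. -/
lemma measure_inter_le_mul_of_tree {X ι : Type*} [MeasurableSpace X] [Countable ι]
    [MeasurableSpace ι] [MeasurableSingletonClass ι] {π : ℕ → X → ι} (hπ : ∀ l, Measurable (π l))
    {par : ι → ι} (hpar : ∀ l x, π l x = par (π (l + 1) x)) {μ : Measure X}
    {q : ENNReal} (hq : q < 1) {A G Q₀ : Set X} (hA : MeasurableSet A) (hG : MeasurableSet G)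
    (hfin : μ Q₀ ≠ ⊤) {L : ℕ} (hleaf : ∀ x x', π L x = π L x' → x ∈ A → x' ∈ A)
    (hQ : ∀ l < L, ∀ k, π (l + 1) ⁻¹' {k} ⊆ Q₀ →
      q * μ (π (l + 1) ⁻¹' {k}) < μ (A ∩ π (l + 1) ⁻¹' {k}) → π l ⁻¹' {par k} ⊆ G)
    (j : ℕ) : ∀ l k, l + j = L → π l ⁻¹' {k} ⊆ Q₀ →
      μ (A ∩ π l ⁻¹' {k}) ≤ q * μ (π l ⁻¹' {k}) →
      μ (A ∩ π l ⁻¹' {k}) ≤ q * μ (G ∩ π l ⁻¹' {k}) := by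
  induction j with
  | zero =>
    intro l k hl hk h
    obtain rfl : l = L := by simpa using hl
    by_cases hne : (A ∩ π l ⁻¹' {k}).Nonempty
    · obtain ⟨x, hxA, hx⟩ := hne
      have hsub : A ∩ π l ⁻¹' {k} = π l ⁻¹' {k} :=
        Set.inter_eq_right.2 fun x' hx' => hleaf x x' (hx.trans (Eq.symm hx')) hxA
      have h0 : μ (π l ⁻¹' {k}) = 0 := by
        by_contra hne
        rw [hsub] at h
        have := ENNReal.mul_lt_mul_left hne (measure_ne_top_of_subset hk hfin) hq
        rw [one_mul] at this
        exact absurd h (not_le.2 this)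
      rw [hsub, h0]
      exact zero_le
    · rw [Set.not_nonempty_iff_eq_empty.1 hne, measure_empty]
      exact zero_le
  | succ j ih =>
    intro l k hl hk h
    have hpre : π l ⁻¹' {k} = π (l + 1) ⁻¹' (par ⁻¹' {k}) := by
      ext x
      rw [Set.mem_preimage, hpar]
      rfl
    by_cases hex : ∃ k', par k' = k ∧
        q * μ (π (l + 1) ⁻¹' {k'}) < μ (A ∩ π (l + 1) ⁻¹' {k'})
    · obtain ⟨k', rfl, hk'⟩ := hex
      have hs : π (l + 1) ⁻¹' {k'} ⊆ Q₀ := fun x hx => hk (by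
        rw [hpre]
        exact congrArg par hx)
      rwa [Set.inter_eq_right.2 (hQ l (by omega) k' hs hk')]
    · push Not at hex
      have key := measure_preimage_le (hπ (l + 1)) (ν₁ := μ.restrict A) (ν₂ := q • μ.restrict G)
        (S := par ⁻¹' {k}) fun k' hk' => by
          have hs : π (l + 1) ⁻¹' {k'} ⊆ Q₀ := fun x hx => hk (by
            rw [hpre]
            exact (congrArg par hx).trans hk')
          have := ih (l + 1) k' (by omega) hs (hex k' hk')
          rw [Measure.smul_apply, Measure.restrict_apply' hA, Measure.restrict_apply' hG,
            Set.inter_comm, Set.inter_comm _ G]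
          exact this
      rw [← hpre, Measure.smul_apply, Measure.restrict_apply' hA, Measure.restrict_apply' hG,
        Set.inter_comm, Set.inter_comm _ G] at key
      exact key

/-- The index of the dyadic cube of side `2⁻ˡ` containing `x`. -/
noncomputable def cell (l : ℕ) (x : E) : Fin N → ℤ := fun i => ⌊2 ^ l * x i⌋

/-- The centre of a dyadic cube. -/
noncomputable def center (l : ℕ) (k : Fin N → ℤ) : E :=
  WithLp.toLp 2 fun i => (k i + 1 / 2) * (1 / 2) ^ l

lemma measurable_cell (l : ℕ) : Measurable (cell (N := N) l) := by
  refine measurable_pi_lambda _ fun i => Int.measurable_floor.comp ?_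
  fun_prop

lemma cell_succ (l : ℕ) (x : E) : cell l x = fun i => cell (l + 1) x i / 2 := by
  ext i
  simp only [cell]
  rw [Int.floor_eq_iff]
  have h1 := Int.floor_le (2 ^ (l + 1) * x i)
  have h2 := Int.lt_floor_add_one (2 ^ (l + 1) * x i)
  set n := ⌊2 ^ (l + 1) * x i⌋
  have h3 : ((2 * (n / 2) : ℤ) : ℝ) ≤ n := by exact_mod_cast (by omega)
  have h4 : (n : ℝ) + 1 ≤ ((2 * (n / 2) + 2 : ℤ) : ℝ) := by exact_mod_cast (by omega)
  push_cast at h3 h4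
  rw [pow_succ] at h1 h2
  constructor <;> linarith

lemma cell_eq_of_le {l L : ℕ} (h : l ≤ L) {x x' : E} (hx : cell L x = cell L x') :
    cell l x = cell l x' := by
  induction L, h using Nat.le_induction with
  | base => exact hx
  | succ L _ ih =>
    refine ih ?_
    rw [cell_succ, hx, ← cell_succ]

lemma cell_center (l : ℕ) (k : Fin N → ℤ) : cell l (center l k) = k := by
  ext i
  simp only [cell, center]
  rw [Int.floor_eq_iff]
  have : (2 : ℝ) ^ l * ((k i + 1 / 2) * (1 / 2) ^ l) = k i + 1 / 2 := by
    rw [mul_comm, mul_assoc, ← mul_pow]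
    norm_num
  rw [this]
  constructor <;> linarith

lemma norm_le_of_forall_abs_le {x : E} {M : ℝ} (hM : 0 ≤ M) (h : ∀ i, |x i| ≤ M) :
    ‖x‖ ≤ N * M := by
  refine abs_le_of_sq_le_sq ?_ (by positivity) |>.trans' (le_abs_self _)
  rw [EuclideanSpace.norm_sq_eq]
  have h1 : ∑ i, ‖x i‖ ^ 2 ≤ ∑ _i : Fin N, M ^ 2 := Finset.sum_le_sum fun i _ => by
    rw [Real.norm_eq_abs]
    exact pow_le_pow_left₀ (abs_nonneg _) (h i) 2
  refine h1.trans ?_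
  rw [Finset.sum_const, Finset.card_univ, Fintype.card_fin, nsmul_eq_mul, mul_pow]
  gcongr
  exact_mod_cast Nat.le_self_pow two_ne_zero N

lemma dist_le_of_cell_eq {l : ℕ} {x y : E} (h : cell l x = cell l y) :
    dist x y ≤ N * (1 / 2) ^ l := by
  rw [dist_eq_norm]
  refine norm_le_of_forall_abs_le (by positivity) fun i => ?_
  have hi : ⌊2 ^ l * x i⌋ = ⌊2 ^ l * y i⌋ := congrFun h i
  have := Int.abs_sub_lt_one_of_floor_eq_floor hi
  rw [← mul_sub, abs_mul, abs_of_pos (by positivity)] at this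
  rw [PiLp.sub_apply, one_div, inv_pow, ← one_div, le_div_iff₀ (by positivity)]
  linarith

lemma ball_center_subset (l : ℕ) (k : Fin N → ℤ) :
    ball (center l k) ((1 / 2) ^ l * (1 / 2)) ⊆ cell l ⁻¹' {k} := by
  intro x hx
  ext i
  simp only [cell]
  rw [Int.floor_eq_iff]
  have h1 : |x i - (k i + 1 / 2) * (1 / 2) ^ l| < (1 / 2) ^ l * (1 / 2) := by
    refine lt_of_le_of_lt ?_ (mem_ball.1 hx)
    rw [dist_eq_norm]
    exact PiLp.norm_apply_le (x - center l k) i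
  have h2 := mul_lt_mul_of_pos_left h1 (show (0 : ℝ) < 2 ^ l by positivity)
  have e : (2 : ℝ) ^ l * (1 / 2) ^ l = 1 := by rw [← mul_pow]; norm_num
  rw [← abs_of_pos (show (0 : ℝ) < 2 ^ l by positivity), ← abs_mul,
    abs_of_pos (show (0 : ℝ) < 2 ^ l by positivity), ← mul_assoc, e, mul_sub,
    show (2 : ℝ) ^ l * ((k i + 1 / 2) * (1 / 2) ^ l) = (k i + 1 / 2) * (2 ^ l * (1 / 2) ^ l) by ring,
    e, abs_lt] at h2
  constructor <;> linarith

lemma volume_cell_le (l : ℕ) (k : Fin N → ℤ) : volume (cell (N := N) l ⁻¹' {k}) ≤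
    ENNReal.ofReal (((1 / 2) ^ l) ^ N) * volume (ball (0 : E) (N + 1)) := by
  have h : volume (ball (center l k) ((1 / 2) ^ l * (N + 1))) =
      ENNReal.ofReal (((1 / 2) ^ l) ^ N) * volume (ball (0 : E) (N + 1)) := by
    rw [volume_ball_eq _ (by positivity), volume_ball_eq (0 : E) (r := N + 1) (by positivity),
      mul_pow, ENNReal.ofReal_mul (by positivity), mul_assoc]
  rw [← h]
  refine measure_mono fun x hx => ?_
  have := dist_le_of_cell_eq (hx.trans (cell_center l k).symm)
  have h2 : (0 : ℝ) < (1 / 2) ^ l := by positivity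
  rw [mem_ball]
  linarith

lemma volume_cell_ne_top (l : ℕ) (k : Fin N → ℤ) : volume (cell (N := N) l ⁻¹' {k}) ≠ ⊤ :=
  ((volume_cell_le l k).trans_lt
    (ENNReal.mul_lt_top ENNReal.ofReal_lt_top measure_ball_lt_top)).ne

lemma volume_cell_pos (l : ℕ) (k : Fin N → ℤ) : 0 < volume (cell (N := N) l ⁻¹' {k}) :=
  (volume_ball_pos (center l k) (by positivity)).trans_le (measure_mono (ball_center_subset l k))

/-- The union of the dyadic cubes of generation `L` on which `v ≥ t`. -/
def saturatedSet (L : ℕ) (v : E → ℝ) (t : ℝ) : Set E :=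
  {x | ∀ x', cell L x' = cell L x → t ≤ v x'}

lemma measurableSet_saturatedSet (L : ℕ) (v : E → ℝ) (t : ℝ) :
    MeasurableSet (saturatedSet L v t) := by
  have : saturatedSet L v t = cell L ⁻¹' {k | ∀ x', cell L x' = k → t ≤ v x'} := rfl
  rw [this]
  exact measurable_cell L (Set.to_countable _).measurableSet

lemma le_of_density_cell {Λ α β R K c σ ε₁ : ℝ} (hest : MeasureEstimate N Λ α β R K c σ ε₁)
    {d : ENNReal} (hd1 : d ≤ 1) (hd : d * volume (ball (0 : E) (N + 1)) ≤ ENNReal.ofReal c)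
    {ε κ t : ℝ} (hσ : 0 ≤ σ) (ht : 0 < t) (hε : 0 < ε) {l : ℕ} (hε₁ : ε ≤ ε₁ * (1 / 2) ^ l)
    (hκ : κ ≤ σ * t * ε ^ 2) {v : E → ℝ} (hv : Measurable v) (hvb : ∃ K, ∀ x, |v x| ≤ K)
    {k : Fin N → ℤ} (hsup : IsSuper Λ α β ε κ v (ball (center l k) ((1 / 2) ^ l * (R + 2))))
    (h0 : ∀ x ∈ ball (center l k) ((1 / 2) ^ l * (R + 2)), 0 ≤ v x)
    {A : Set E} (hA : MeasurableSet A) (hAv : ∀ x ∈ A, K * t < v x)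
    (h : (1 - d) * volume (cell (N := N) l ⁻¹' {k}) < volume (A ∩ cell l ⁻¹' {k})) :
    ∀ x ∈ ball (center l k) ((1 / 2) ^ l * R), t ≤ v x := by
  by_contra! hx
  obtain ⟨x, hx, hxt⟩ := hx
  have hr : (0 : ℝ) < (1 / 2) ^ l := by positivity
  have hκ' : κ ≤ σ * t * (ε / (1 / 2) ^ l) ^ 2 := by
    refine hκ.trans ?_
    gcongr
    exact le_div_self hε.le hr (pow_le_one₀ (by norm_num) (by norm_num))
  have key := measure_estimate_scaled hest hr ht hε hε₁ hκ' hv hvb hsup h0 ⟨x, hx, hxt.le⟩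
  set Q : Set E := cell l ⁻¹' {k} with hQ
  have hQfin : volume Q ≠ ⊤ := volume_cell_ne_top l k
  have h1 : d * volume Q ≤ volume (Q \ A) := by
    calc d * volume Q ≤ d * (ENNReal.ofReal (((1 / 2) ^ l) ^ N) * volume (ball (0 : E) (N + 1))) := by
          gcongr
          exact volume_cell_le l k
      _ = ENNReal.ofReal (((1 / 2) ^ l) ^ N) * (d * volume (ball (0 : E) (N + 1))) := by ring
      _ ≤ ENNReal.ofReal (((1 / 2) ^ l) ^ N) * ENNReal.ofReal c := by gcongr
      _ ≤ _ := key
      _ ≤ volume (Q \ A) := measure_mono fun y hy =>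
          ⟨ball_center_subset l k hy.2, fun hyA => not_lt.2 hy.1 (hAv y hyA)⟩
  have h2 : volume (A ∩ Q) + volume (Q \ A) = volume Q := by
    rw [Set.inter_comm]
    exact measure_inter_add_sdiff Q hA
  have h3 : (1 - d) * volume Q + d * volume Q = volume Q := by
    rw [← add_mul, tsub_add_cancel_of_le hd1, one_mul]
  have h4 : d * volume Q ≠ ⊤ := ENNReal.mul_ne_top (hd1.trans_lt ENNReal.one_lt_top).ne hQfin
  have h5 : volume (A ∩ Q) ≤ (1 - d) * volume Q := by
    rw [← ENNReal.add_le_add_iff_right h4, h3]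
    exact (add_le_add_right h1 _).trans h2.le
  exact absurd h (not_lt.2 h5)

lemma norm_center_le {l : ℕ} {k : Fin N → ℤ} (h : cell (N := N) l ⁻¹' {k} ⊆ cell 0 ⁻¹' {0}) :
    ‖center l k‖ ≤ N := by
  have h1 : cell 0 (center l k) = 0 := h (cell_center l k)
  have h2 : cell 0 (0 : E) = 0 := by
    ext i
    simp [cell]
  have := dist_le_of_cell_eq (h1.trans h2.symm)
  simpa using this

lemma le_on_root_of_density {Λ α β K c σ ε₁ : ℝ}
    (hest : MeasureEstimate N Λ α β (2 * N + 1) K c σ ε₁) (hK : 1 ≤ K)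
    {d : ENNReal} (hd0 : 0 < d) (hd1 : d ≤ 1)
    (hd : d * volume (ball (0 : E) (N + 1)) ≤ ENNReal.ofReal c)
    {ε κ : ℝ} (hσ : 0 ≤ σ) (hε₁0 : 0 ≤ ε₁) (hε : 0 < ε) {L : ℕ} (hε₁ : ε ≤ ε₁ * (1 / 2) ^ L)
    {v : E → ℝ} (hv : Measurable v) (hvb : ∃ K, ∀ x, |v x| ≤ K)
    (hsup : IsSuper Λ α β ε κ v (ball 0 (3 * N + 3)))
    (h0 : ∀ x ∈ ball (0 : E) (3 * N + 3), 0 ≤ v x) (n : ℕ) :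
    ∀ t : ℝ, 0 < t → κ ≤ σ * (t / (2 * K) ^ n) * ε ^ 2 →
      (1 - d) ^ n * volume (cell (N := N) 0 ⁻¹' {0}) <
        volume (saturatedSet L v t ∩ cell 0 ⁻¹' {0}) →
      ∀ x : E, cell 0 x = 0 → t / (2 * K) ^ n ≤ v x := by
  induction n with
  | zero =>
    intro t _ _ h
    rw [pow_zero, one_mul] at h
    exact absurd (measure_mono Set.inter_subset_right) (not_le.2 h)
  | succ n ih =>
    intro t ht hκ h
    have hpK : 1 ≤ (2 * K) ^ n := one_le_pow₀ (by linarith)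
    have e : t / (2 * K) ^ (n + 1) = t / (2 * K) / (2 * K) ^ n := by
      rw [pow_succ, div_div, mul_comm]
    have ht' : 0 < t / (2 * K) := by positivity
    rw [e] at hκ ⊢
    have hle : t / (2 * K) / (2 * K) ^ n ≤ t / (2 * K) := div_le_self ht'.le hpK
    have hκ' : κ ≤ σ * (t / (2 * K)) * ε ^ 2 := hκ.trans (by gcongr)
    have step : ∀ l ≤ L, ∀ k, cell (N := N) l ⁻¹' {k} ⊆ cell 0 ⁻¹' {0} →
        (1 - d) * volume (cell (N := N) l ⁻¹' {k}) <
          volume (saturatedSet L v t ∩ cell l ⁻¹' {k}) →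
        ∀ x ∈ ball (center l k) ((1 / 2) ^ l * (2 * N + 1)), t / (2 * K) ≤ v x := by
      intro l hl k hk hlt
      have hsub : ball (center l k) ((1 / 2) ^ l * (2 * N + 1 + 2)) ⊆ ball (0 : E) (3 * N + 3) := by
        refine ball_subset_ball' ?_
        rw [dist_zero_right]
        have := norm_center_le hk
        have h2 : (1 / 2 : ℝ) ^ l * (2 * N + 1 + 2) ≤ 1 * (2 * N + 1 + 2) := by
          gcongr
          exact pow_le_one₀ (by norm_num) (by norm_num)
        linarith
      refine le_of_density_cell hest hd1 hd hσ ht' hε ?_ hκ' hv hvb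
        (fun x hx => hsup x (hsub hx)) (fun x hx => h0 x (hsub hx))
        (measurableSet_saturatedSet L v t) (fun x hx => ?_) hlt
      · refine hε₁.trans (mul_le_mul_of_nonneg_left ?_ hε₁0)
        exact pow_le_pow_of_le_one (by norm_num) (by norm_num) hl
      · refine lt_of_lt_of_le ?_ (hx x rfl)
        have : K * (t / (2 * K)) = t / 2 := by field_simp
        linarith
    by_cases hroot : (1 - d) * volume (cell (N := N) 0 ⁻¹' {0}) <
        volume (saturatedSet L v t ∩ cell 0 ⁻¹' {0})
    · intro x hx
      refine hle.trans (step 0 (Nat.zero_le _) 0 subset_rfl hroot x ?_)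
      have := dist_le_of_cell_eq (hx.trans (cell_center 0 0).symm)
      rw [mem_ball]
      simp only [pow_zero, mul_one, one_mul] at this ⊢
      have hN : (0 : ℝ) ≤ N := Nat.cast_nonneg N
      linarith
    · have hq : 1 - d < 1 := ENNReal.sub_lt_self ENNReal.one_ne_top one_ne_zero hd0.ne'
      have tree := measure_inter_le_mul_of_tree (μ := volume) measurable_cell
        (par := fun k i => k i / 2) cell_succ hq (measurableSet_saturatedSet L v t)
        (measurableSet_saturatedSet L v (t / (2 * K))) (volume_cell_ne_top 0 0)
        (L := L) (fun x x' hxx' hx y hy => hx y (hy.trans hxx'.symm))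
        (fun l hl k hk hlt => by
          intro x hx y hy
          refine step (l + 1) hl k hk hlt y ?_
          have h1 : cell l y = cell l x := cell_eq_of_le hl.le hy
          have h2 : cell l (center (l + 1) k) = fun i => k i / 2 := by
            rw [cell_succ, cell_center]
          have h3 := dist_le_of_cell_eq (h1.trans (hx.trans h2.symm))
          have h4 : (0 : ℝ) < (1 / 2) ^ l := by positivity
          rw [mem_ball, pow_succ]
          linarith)
        L 0 0 (zero_add L) subset_rfl (not_lt.1 hroot)
      refine ih _ ht' hκ ?_
      rw [pow_succ', mul_assoc] at h
      exact lt_of_mul_lt_mul_left' (h.trans_le tree)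

lemma IsSuper.le_chain {Λ α β ε κ : ℝ} (hα : 0 ≤ α) (hβ : 0 ≤ β) (hβ1 : β ≤ 1) (hε : 0 < ε)
    {r : ℝ} (hr : ε ≤ r) (hΛ : ε * Λ ≤ r) {v : E → ℝ} {Ω : Set E} (hv : Measurable v)
    {K : ℝ} (hK : ∀ x, |v x| ≤ K) (h : IsSuper Λ α β ε κ v Ω) {c : E} {s : ℝ} (hs : 0 ≤ s)
    (h1 : ∀ x ∈ ball c (ε / 2), s ≤ v x) (m : ℕ) (hκ : κ ≤ (β * (1 / 4) ^ N / 2) ^ m * s)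
    (hΩ : ball c ((m + 1) * (ε / 2)) ⊆ Ω)
    (h0 : ∀ x ∈ ball c ((m + 1) * (ε / 2) + r), 0 ≤ v x) :
    ∀ x ∈ ball c ((m + 1) * (ε / 2)), (β * (1 / 4) ^ N / 2) ^ m * s ≤ v x := by
  set a : ℝ := β * (1 / 4) ^ N / 2 with ha
  have ha0 : 0 ≤ a := by positivity
  have ha1 : a ≤ 1 := by
    have : β * (1 / 4) ^ N ≤ 1 := mul_le_one₀ hβ1 (by positivity)
      (pow_le_one₀ (by norm_num) (by norm_num))
    linarith
  induction m with
  | zero => simpa using h1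
  | succ m ih =>
    intro x hx
    push_cast at hx hΩ h0
    have hmono : (m + 1 : ℝ) * (ε / 2) ≤ (m + 1 + 1) * (ε / 2) := by gcongr; linarith
    have hpow : a ^ (m + 1) * s ≤ a ^ m * s := by
      gcongr ?_ * s
      exact pow_le_pow_of_le_one ha0 ha1 m.le_succ
    have ih' := ih ((ball_subset_ball hmono).trans hΩ)
      (fun x hx => h0 x (ball_subset_ball (by linarith) hx)) (hκ.trans hpow)
    have hm : (0 : ℝ) < m + 2 := by positivity
    set lam : ℝ := (m + 1 / 2) / (m + 2) with hlam
    have hl0 : 0 ≤ lam := by positivity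
    have hl1 : 1 - lam = (3 / 2) / (m + 2) := by rw [hlam]; field_simp; ring
    have hl1' : 0 ≤ 1 - lam := by rw [hl1]; positivity
    have hd : ‖x - c‖ < (m + 2) * (ε / 2) := by
      rw [mem_ball, dist_eq_norm] at hx
      linarith
    set y : E := c + lam • (x - c) with hy
    have hyc : dist y c ≤ (m + 1 / 2) * (ε / 2) := by
      rw [hy, dist_eq_norm, add_sub_cancel_left, norm_smul, Real.norm_eq_abs, abs_of_nonneg hl0]
      calc lam * ‖x - c‖ ≤ lam * ((m + 2) * (ε / 2)) := by gcongr
        _ = _ := by rw [hlam]; field_simp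
    have hyx : dist y x ≤ 3 / 2 * (ε / 2) := by
      have e : y - x = -((1 - lam) • (x - c)) := by rw [hy]; module
      rw [dist_eq_norm, e, norm_neg, norm_smul, Real.norm_eq_abs, abs_of_nonneg hl1']
      calc (1 - lam) * ‖x - c‖ ≤ (1 - lam) * ((m + 2) * (ε / 2)) := by gcongr
        _ = _ := by rw [hl1]; field_simp
    have key := h.le_of_density hα hβ hε hv hK (hΩ hx) hr hΛ
      (fun z hz => h0 z (by
        rw [mem_ball] at hz hx ⊢
        linarith [dist_triangle z x c]))
      (S := ball y (ε / 4)) (ball_subset_ball' (by linarith)) (s := a ^ m * s) (δ := (1 / 4) ^ N)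
      (by positivity) (fun z hz => ih' z (by
        rw [mem_ball] at hz ⊢
        linarith [dist_triangle z y c]))
      (by
        rw [volume_ball_eq x hε, volume_ball_eq y (by positivity), ← mul_assoc,
          ← ENNReal.ofReal_mul (by positivity), ← mul_pow]
        apply le_of_eq
        congr 3
        ring)
    have e : β * ((1 / 4) ^ N * (a ^ m * s)) = 2 * (a ^ (m + 1) * s) := by rw [ha]; ring
    rw [e] at key
    linarith

lemma cell_sub (J : ℕ) : ∃ par : (Fin N → ℤ) → (Fin N → ℤ),
    ∀ l (x : E), cell l x = par (cell (l + J) x) := by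
  induction J with
  | zero => exact ⟨id, fun l x => rfl⟩
  | succ J ih =>
    obtain ⟨par, h⟩ := ih
    exact ⟨fun k => par fun i => k i / 2, fun l x => by rw [h, cell_succ]; rfl⟩

lemma exists_subcell {δ : ENNReal} {A : Set E} (hA : MeasurableSet A) {l : ℕ} {k : Fin N → ℤ}
    (h : δ * volume (cell (N := N) l ⁻¹' {k}) < volume (A ∩ cell l ⁻¹' {k})) (J : ℕ) :
    ∃ k', cell (N := N) (l + J) ⁻¹' {k'} ⊆ cell l ⁻¹' {k} ∧
      δ * volume (cell (N := N) (l + J) ⁻¹' {k'}) < volume (A ∩ cell (l + J) ⁻¹' {k'}) := by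
  obtain ⟨par, hpar⟩ := cell_sub (N := N) J
  by_contra! hcon
  have hpre : cell (N := N) l ⁻¹' {k} = cell (l + J) ⁻¹' (par ⁻¹' {k}) := by
    ext x
    rw [Set.mem_preimage, hpar]
    rfl
  have key := measure_preimage_le (measurable_cell (N := N) (l + J)) (ν₁ := volume.restrict A)
    (ν₂ := δ • volume) (S := par ⁻¹' {k}) fun k' hk' => by
      have := hcon k' fun x hx => by
        rw [hpre]
        exact (congrArg par hx).trans hk'
      rw [Measure.smul_apply, Measure.restrict_apply' hA, Set.inter_comm]
      exact this
  rw [← hpre, Measure.smul_apply, Measure.restrict_apply' hA, Set.inter_comm] at key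
  exact absurd h (not_lt.2 key)

lemma volume_saturatedSet_ge {δ : ENNReal} {v : E → ℝ} (hδ : δ ≠ ⊤) {A : Set E}
    (hA : MeasurableSet A) {L : ℕ} {t : ℝ}
    (hleaf : ∀ k, cell (N := N) L ⁻¹' {k} ⊆ cell 0 ⁻¹' {0} →
      δ * volume (cell (N := N) L ⁻¹' {k}) < volume (A ∩ cell L ⁻¹' {k}) →
      ∀ x, cell L x = k → t ≤ v x)
    (h : 2 * δ * volume (cell (N := N) 0 ⁻¹' {0}) ≤ volume (A ∩ cell 0 ⁻¹' {0})) :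
    δ * volume (cell (N := N) 0 ⁻¹' {0}) ≤ volume (saturatedSet L v t ∩ cell 0 ⁻¹' {0}) := by
  obtain ⟨par, hpar⟩ := cell_sub (N := N) L
  have hpre : cell (N := N) 0 ⁻¹' {0} = cell L ⁻¹' (par ⁻¹' {0}) := by
    ext x
    rw [Set.mem_preimage, hpar, zero_add]
    rfl
  have hF := measurableSet_saturatedSet L v t
  have key := measure_preimage_le (measurable_cell (N := N) L) (ν₁ := volume.restrict A)
    (ν₂ := δ • volume + volume.restrict (saturatedSet L v t)) (S := par ⁻¹' {0}) fun k hk => by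
      rw [Measure.add_apply, Measure.smul_apply, Measure.restrict_apply' hA,
        Measure.restrict_apply' hF, smul_eq_mul, Set.inter_comm]
      by_cases hlt : δ * volume (cell (N := N) L ⁻¹' {k}) < volume (A ∩ cell L ⁻¹' {k})
      · have hs : cell (N := N) L ⁻¹' {k} ⊆ cell 0 ⁻¹' {0} := fun x hx => by
          rw [hpre]
          exact (congrArg par hx).trans hk
        have : cell (N := N) L ⁻¹' {k} ∩ saturatedSet L v t = cell L ⁻¹' {k} :=
          Set.inter_eq_left.2 fun x hx y hy => hleaf k hs hlt y (hy.trans hx)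
        rw [this]
        exact (measure_mono Set.inter_subset_right).trans le_add_self
      · exact (not_lt.1 hlt).trans le_self_add
  rw [← hpre, Measure.add_apply, Measure.smul_apply, Measure.restrict_apply' hA,
    Measure.restrict_apply' hF, smul_eq_mul, Set.inter_comm, Set.inter_comm _ (saturatedSet L v t)]
    at key
  have hfin : δ * volume (cell (N := N) 0 ⁻¹' {0}) ≠ ⊤ :=
    ENNReal.mul_ne_top hδ (volume_cell_ne_top 0 0)
  rw [← ENNReal.add_le_add_iff_left hfin]
  refine le_trans (le_of_eq ?_) (h.trans key)
  ring

lemma le_on_cell_of_density {Λ α β ε ε₁ κ : ℝ} (hα : 0 ≤ α) (hβ : 0 ≤ β) (hβ1 : β ≤ 1)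
    (hΛ : 1 ≤ Λ) (hε : 0 < ε) (hεε₁ : ε ≤ ε₁) (hε₁Λ : ε₁ * Λ ≤ 1 / 4) {L J m : ℕ}
    (hL : ε ≤ ε₁ * (1 / 2) ^ L) (hL' : ε₁ * (1 / 2) ^ L < 2 * ε)
    (hJ : N * (1 / 2) ^ J * 4 < ε₁) (hm : 4 * N < (m + 1) * ε₁)
    {v : E → ℝ} (hv : Measurable v) (hvb : ∃ K, ∀ x, |v x| ≤ K)
    (hsup : IsSuper Λ α β ε κ v (ball 0 (3 * N + 3 + (m + 1) * ε₁)))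
    (h0 : ∀ x ∈ ball (0 : E) (3 * N + 3 + (m + 1) * ε₁), 0 ≤ v x)
    {δ t : ℝ} (hδ : 0 ≤ δ) (ht : 0 ≤ t)
    (hκ : κ ≤ (β * (1 / 4) ^ N / 2) ^ m * (β * (δ * ((1 / 2) ^ J / (2 * ε₁)) ^ N * t) / 2))
    {k : Fin N → ℤ} (hk : cell (N := N) L ⁻¹' {k} ⊆ cell 0 ⁻¹' {0})
    (h : ENNReal.ofReal δ * volume (cell (N := N) L ⁻¹' {k}) <
      volume ({x | t ≤ v x} ∩ cell L ⁻¹' {k})) (x : E) (hx : cell L x = k) :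
    (β * (1 / 4) ^ N / 2) ^ m * (β * (δ * ((1 / 2) ^ J / (2 * ε₁)) ^ N * t) / 2) ≤ v x := by
  have hε₁ : 0 < ε₁ := hε.trans_le hεε₁
  obtain ⟨K, hK⟩ := hvb
  obtain ⟨k', hk', hd⟩ := exists_subcell (measurableSet_le measurable_const hv) h J
  set p : E := center (L + J) k' with hp
  have hpN : ‖p‖ ≤ N := norm_center_le (hk'.trans hk)
  have hpk : cell L p = k := hk' (cell_center _ _)
  have hε4 : ε₁ ≤ 1 / 4 := by nlinarith
  have hr : ε ≤ 1 / 4 := hεε₁.trans hε4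
  have hεΛ : ε * Λ ≤ 1 / 4 := le_trans (by gcongr) hε₁Λ
  set d₀ : ℝ := ((1 / 2) ^ J / (2 * ε₁)) ^ N with hd₀
  set s : ℝ := β * (δ * d₀ * t) / 2 with hs
  have hs0 : 0 ≤ s := by positivity
  have hmε : (m + 1 : ℝ) * (ε / 2) ≤ (m + 1) * ε₁ := by gcongr; linarith
  have hΩ : ball p ((m + 1) * (ε / 2) + 1 / 4) ⊆ ball (0 : E) (3 * N + 3 + (m + 1) * ε₁) := by
    refine ball_subset_ball' ?_
    rw [dist_zero_right]
    have : (0 : ℝ) ≤ N := Nat.cast_nonneg N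
    linarith
  have hm1 : ε / 2 ≤ (m + 1 : ℝ) * (ε / 2) := le_mul_of_one_le_left (by positivity) (by
    have : (0 : ℝ) ≤ m := Nat.cast_nonneg m
    linarith)
  have hκs : κ ≤ s := by
    refine hκ.trans (mul_le_of_le_one_left hs0 (pow_le_one₀ (by positivity) ?_))
    have : β * (1 / 4) ^ N ≤ 1 := mul_le_one₀ hβ1 (by positivity)
      (pow_le_one₀ (by norm_num) (by norm_num))
    linarith
  have hsub : cell (L + J) ⁻¹' {k'} ⊆ ball p (ε / 2) := by
    intro y hy
    refine (dist_le_of_cell_eq (hy.trans (cell_center _ _).symm)).trans_lt ?_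
    refine lt_of_mul_lt_mul_left ?_ hε₁.le
    calc ε₁ * (N * (1 / 2) ^ (L + J)) = (ε₁ * (1 / 2) ^ L) * (N * (1 / 2) ^ J) := by ring
      _ ≤ 2 * ε * (N * (1 / 2) ^ J) := by gcongr
      _ = ε / 2 * (N * (1 / 2) ^ J * 4) := by ring
      _ < ε / 2 * ε₁ := by gcongr
      _ = _ := mul_comm _ _
  have hstart : ∀ y ∈ ball p (ε / 2), s ≤ v y := by
    intro y hy
    have key := hsup.le_of_density hα hβ hε hv hK
      (hΩ (ball_subset_ball (by linarith) hy)) hr hεΛ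
      (fun z hz => h0 z (hΩ (by
        rw [mem_ball] at hz hy ⊢
        linarith [dist_triangle z y p])))
      (S := {x | t ≤ v x} ∩ cell (L + J) ⁻¹' {k'}) (s := t) (δ := δ * d₀)
      (fun z hz => by
        have := hsub hz.2
        rw [mem_ball] at this hy ⊢
        rw [dist_comm] at hy
        linarith [dist_triangle z p y]) ht (fun z hz => hz.1) (by
        refine le_trans ?_ hd.le
        rw [ENNReal.ofReal_mul hδ, mul_assoc]
        gcongr
        refine le_trans ?_ (measure_mono (ball_center_subset (L + J) k'))
        rw [volume_ball_eq y hε, volume_ball_eq (center (L + J) k') (by positivity), ← mul_assoc,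
          ← ENNReal.ofReal_mul (by positivity), hd₀, ← mul_pow]
        gcongr ENNReal.ofReal (?_ ^ N) * _
        rw [div_mul_eq_mul_div, div_le_iff₀ (by positivity)]
        calc (1 / 2 : ℝ) ^ J * ε ≤ (1 / 2) ^ J * (ε₁ * (1 / 2) ^ L) := by gcongr
          _ = _ := by ring)
    linarith
  refine hsup.le_chain hα hβ hβ1 hε hr hεΛ hv hK hs0 hstart m hκ
    ((ball_subset_ball (by linarith)).trans hΩ) (fun y hy => h0 y (hΩ hy)) x ?_
  refine (dist_le_of_cell_eq (hx.trans hpk.symm)).trans_lt ?_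
  refine lt_of_mul_lt_mul_left ?_ hε₁.le
  calc ε₁ * (N * (1 / 2) ^ L) = N * (ε₁ * (1 / 2) ^ L) := by ring
    _ ≤ N * (2 * ε) := by gcongr
    _ = 4 * N * (ε / 2) := by ring
    _ < (m + 1) * ε₁ * (ε / 2) := by gcongr
    _ = _ := by ring

lemma growth_on_unit_cube (N : ℕ) {Λ α β : ℝ} (hα : 0 ≤ α) (hβ : 0 < β) (hαβ : α + β = 1)
    (hΛ : 1 ≤ Λ) : ∃ k₁ ε₁ : ℝ, 0 < k₁ ∧ 0 < ε₁ ∧ ε₁ * Λ ≤ 1 / 4 ∧ ∀ θ : ℝ, 0 < θ →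
      ∃ η σ : ℝ, 0 < η ∧ 0 < σ ∧ ∀ ε κ t : ℝ, 0 < ε → ε ≤ ε₁ → 0 < t → κ ≤ σ * t * ε ^ 2 →
        ∀ v : EuclideanSpace ℝ (Fin N) → ℝ, Measurable v → (∃ K, ∀ x, |v x| ≤ K) →
        IsSuper Λ α β ε κ v (ball 0 k₁) → (∀ x ∈ ball 0 k₁, 0 ≤ v x) →
        ENNReal.ofReal θ * volume (cell (N := N) 0 ⁻¹' {0}) ≤
          volume ({x | t ≤ v x} ∩ cell 0 ⁻¹' {0}) →
        ∀ x, cell 0 x = 0 → η * t ≤ v x := by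
  obtain ⟨K, c, σ, ε₁, hK, hc, hσ, hε₁, hε₁Λ, hest⟩ :=
    measure_estimate N (R := 2 * N + 1) hα hβ hαβ hΛ (by positivity)
  obtain ⟨m, hm⟩ := exists_nat_gt (4 * N / ε₁)
  have hm' : 4 * N < (m + 1) * ε₁ := by
    rw [div_lt_iff₀ hε₁] at hm
    linarith
  have hJ : ∃ J : ℕ, (N : ℝ) * (1 / 2) ^ J * 4 < ε₁ := by
    obtain ⟨J, hJ⟩ := exists_pow_lt_of_lt_one (show 0 < ε₁ / (4 * (N + 1)) by positivity)
      (show (1 / 2 : ℝ) < 1 by norm_num)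
    refine ⟨J, ?_⟩
    rw [lt_div_iff₀ (by positivity)] at hJ
    have : (0 : ℝ) < (1 / 2) ^ J := by positivity
    linarith
  obtain ⟨J, hJ⟩ := hJ
  refine ⟨3 * N + 3 + (m + 1) * ε₁, ε₁, by positivity, hε₁, hε₁Λ, fun θ hθ => ?_⟩
  set W := volume (ball (0 : EuclideanSpace ℝ (Fin N)) (N + 1)) with hW
  have hWtop : W ≠ ⊤ := volume_ball_ne_top _ _
  set d : ENNReal := min 1 (ENNReal.ofReal c / W) with hd
  have hd0 : 0 < d := lt_min one_pos
    (ENNReal.div_pos (ENNReal.ofReal_pos.2 hc).ne' hWtop)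
  have hd1 : d ≤ 1 := min_le_left _ _
  have hdW : d * W ≤ ENNReal.ofReal c := by
    calc d * W ≤ ENNReal.ofReal c / W * W := by gcongr; exact min_le_right _ _
      _ = _ := ENNReal.div_mul_cancel (volume_ball_pos _ (by positivity)).ne' hWtop
  have hq : 1 - d < 1 := ENNReal.sub_lt_self ENNReal.one_ne_top one_ne_zero hd0.ne'
  obtain ⟨n, hn⟩ := ((ENNReal.tendsto_pow_atTop_nhds_zero_of_lt_one hq).eventually_lt_const
    (ENNReal.ofReal_pos.2 (half_pos hθ))).exists
  set b : ℝ := (β * (1 / 4) ^ N / 2) ^ m *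
    (β * (θ / 2 * ((1 / 2) ^ J / (2 * ε₁)) ^ N) / 2) with hb
  have hb0 : 0 < b := by positivity
  have hbt : ∀ t : ℝ, b * t = (β * (1 / 4) ^ N / 2) ^ m *
    (β * (θ / 2 * ((1 / 2) ^ J / (2 * ε₁)) ^ N * t) / 2) := fun t => by rw [hb]; ring
  refine ⟨b / (2 * K) ^ n, min (σ * (b / (2 * K) ^ n)) (b / ε₁ ^ 2), by positivity,
    by positivity, ?_⟩
  intro ε κ t hε hεε₁ ht hκ v hv hvb hsup h0 hmeas
  obtain ⟨L, hL', hL⟩ := exists_nat_pow_near_of_lt_one (x := ε / ε₁) (y := 1 / 2) (by positivity)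
    ((div_le_one hε₁).2 hεε₁) (by norm_num) (by norm_num)
  rw [div_le_iff₀ hε₁, mul_comm] at hL
  rw [lt_div_iff₀ hε₁, pow_succ] at hL'
  have hκ1 : κ ≤ σ * (b * t / (2 * K) ^ n) * ε ^ 2 := by
    refine hκ.trans ?_
    calc _ ≤ σ * (b / (2 * K) ^ n) * t * ε ^ 2 := by gcongr; exact min_le_left _ _
      _ = _ := by ring
  have hκ2 : κ ≤ b * t := by
    refine hκ.trans ?_
    calc _ ≤ b / ε₁ ^ 2 * t * ε₁ ^ 2 := by gcongr; exact min_le_right _ _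
      _ = _ := by field_simp
  have hθ2 : 2 * ENNReal.ofReal (θ / 2) = ENNReal.ofReal θ := by
    rw [two_mul, ← ENNReal.ofReal_add (half_pos hθ).le (half_pos hθ).le, add_halves]
  have hsat := volume_saturatedSet_ge (v := v) (δ := ENNReal.ofReal (θ / 2)) (t := b * t) (L := L)
    ENNReal.ofReal_ne_top (measurableSet_le measurable_const hv)
    (fun k hk hlt x hx => by
      rw [hbt] at hκ2 ⊢
      exact le_on_cell_of_density hα hβ.le (by linarith) hΛ hε hεε₁ hε₁Λ hL (by linarith) hJ hm'
        hv hvb hsup h0 (half_pos hθ).le ht.le hκ2 hk hlt x hx)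
    (by rwa [hθ2])
  have hsub : ball (0 : EuclideanSpace ℝ (Fin N)) (3 * N + 3) ⊆
      ball 0 (3 * N + 3 + (m + 1) * ε₁) := ball_subset_ball (by
    have : 0 ≤ (m + 1) * ε₁ := by positivity
    linarith)
  intro x hx
  have := le_on_root_of_density hest hK hd0 hd1 hdW hσ.le hε₁.le hε hL hv hvb
    (fun x hx => hsup x (hsub hx)) (fun x hx => h0 x (hsub hx)) n (b * t) (by positivity) hκ1
    ((ENNReal.mul_lt_mul_left (volume_cell_pos 0 0).ne' (volume_cell_ne_top 0 0) hn).trans_le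
      hsat) x hx
  calc _ = b * t / (2 * K) ^ n := by ring
    _ ≤ _ := this

lemma isSuper_const_sub_of_Lplus {Λ α β ε ρ M : ℝ} (hΛ : 0 < Λ) (hα : 0 ≤ α) (hβ : 0 ≤ β)
    (hαβ : α + β = 1) (hε : 0 < ε) (hρ : 0 < ρ) {u : E → ℝ} (hu : Measurable u) {K : ℝ}
    (hK : ∀ x, |u x| ≤ K) {Ω : Set E} (h : ∀ x ∈ Ω, -ρ ≤ Lplus Λ α β ε u x) :
    IsSuper Λ α β ε (2 * ε ^ 2 * ρ) (fun x => M - u x) Ω := by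
  intro x hx
  have hInt : Integrable (fun y => u (x + ε • y)) (unif N) :=
    integrable_unif_of_bounded (by fun_prop) fun y _ => hK _
  have hInt' : Integrable (fun y => u (x - ε • y)) (unif N) :=
    integrable_unif_of_bounded (by fun_prop) fun y _ => hK _
  have hsymm : ∫ y, u (x - ε • y) ∂unif N = ∫ y, u (x + ε • y) ∂unif N := by
    rw [← integral_unif_neg]
    simp
  have hav : ⨍ y in ball (0 : E) 1, ddiff u x (ε • y) =
      2 * (∫ y, u (x + ε • y) ∂unif N - u x) := by
    rw [setAverage_eq_integral_unif]
    simp only [ddiff]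
    have hadd : Integrable (fun y => u (x + ε • y) + u (x - ε • y)) (unif N) := hInt.add hInt'
    rw [integral_sub hadd (integrable_const _), integral_add hInt hInt', hsymm,
      integral_const, probReal_univ, one_smul]
    ring
  have hL := h x hx
  rw [Lplus, hav, one_div, inv_mul_eq_div, le_div_iff₀ (by positivity)] at hL
  have hκ : 0 < 2 * ε ^ 2 * ρ := by positivity
  obtain ⟨_, ⟨z, hz, rfl⟩, hlt⟩ := exists_lt_of_lt_csSup
    (s := (fun z => ddiff u x (ε • z)) '' ball (0 : E) Λ)
    ((nonempty_ball.2 hΛ).image _) (sub_lt_self _ hκ)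
  refine ⟨z, by simpa using hz, ?_⟩
  have h1 := mul_le_mul_of_nonneg_left hlt.le hα
  have h2 : α * (2 * ε ^ 2 * ρ) ≤ 2 * ε ^ 2 * ρ := mul_le_of_le_one_left hκ.le (by linarith)
  rw [integral_sub (integrable_const _) hInt, integral_const, probReal_univ, one_smul]
  set S := sSup ((fun z => ddiff u x (ε • z)) '' ball (0 : E) Λ)
  simp only [ddiff] at h1 ⊢
  obtain rfl : α = 1 - β := by linarith
  linarith

end

end DeGiorgiOscillation

open DeGiorgiOscillation

/-- **De Giorgi oscillation lemma, scaled form.** There exist `k > 1`, `C > 0`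
and `ε₀ > 0`, depending only on `N, Λ, α, β`, such that for every `θ ∈ (0,1)` there exists
`η = η(θ) > 0` with: for every `R > 0`, `0 < ε < ε₀R`, `ρ > 0`, `m, M ∈ ℝ` and every bounded
Borel measurable `u` with `L_ε^+ u ≥ −ρ` in `B_{kR}`, `u ≤ M` in `B_{kR}` and
`|B_R ∩ {u ≤ m}| ≥ θ|B_R|`, one has `sup_{B_R} u ≤ (1−η)M + ηm + CR²ρ`. -/
theorem deGiorgi_oscillation_scaled (N : ℕ) (hN : 1 ≤ N) (Λ α β : ℝ) (hΛ : 1 ≤ Λ)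
    (hβ : β ∈ Set.Ioc (0 : ℝ) 1) (hα : α = 1 - β) :
    ∃ (k C ε₀ : ℝ), 1 < k ∧ 0 < C ∧ 0 < ε₀ ∧
      ∀ θ ∈ Set.Ioo (0 : ℝ) 1, ∃ η > (0 : ℝ),
        ∀ R ρ ε : ℝ, 0 < R → 0 < ρ → 0 < ε → ε < ε₀ * R →
          ∀ m M : ℝ, ∀ u : EuclideanSpace ℝ (Fin N) → ℝ,
            Measurable u → (∃ K, ∀ x, |u x| ≤ K) →
            (∀ x ∈ ball (0 : EuclideanSpace ℝ (Fin N)) (k * R), -ρ ≤ Lplus Λ α β ε u x) →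
            (∀ x ∈ ball (0 : EuclideanSpace ℝ (Fin N)) (k * R), u x ≤ M) →
            ENNReal.ofReal θ * volume (ball (0 : EuclideanSpace ℝ (Fin N)) R) ≤
              volume (ball (0 : EuclideanSpace ℝ (Fin N)) R ∩ {x | u x ≤ m}) →
            ∀ x ∈ ball (0 : EuclideanSpace ℝ (Fin N)) R,
              u x ≤ (1 - η) * M + η * m + C * R ^ 2 * ρ := by
  have hN0 : (0 : ℝ) ≤ N := Nat.cast_nonneg N
  have hα0 : 0 ≤ α := by linarith [hβ.2]
  obtain ⟨k₁, ε₁, hk₁, hε₁, -, hU⟩ :=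
    growth_on_unit_cube N hα0 hβ.1 (by linarith : α + β = 1) hΛ
  refine ⟨2 * k₁ + 2 * N + 1, 8, ε₁, by linarith, by norm_num, hε₁, fun θ hθ => ?_⟩
  set p : EuclideanSpace ℝ (Fin N) := center 0 0 with hp
  have hpN : ‖p‖ ≤ N := norm_center_le subset_rfl
  have hroot : ball p (1 / 2) ⊆ cell 0 ⁻¹' {0} := by
    have := ball_center_subset (N := N) 0 0
    rwa [pow_zero, one_mul] at this
  set Q : Set (EuclideanSpace ℝ (Fin N)) := cell 0 ⁻¹' {0} with hQ
  have hQ0 : volume Q ≠ 0 := (volume_cell_pos 0 0).ne'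
  have hQtop : volume Q ≠ ⊤ := volume_cell_ne_top 0 0
  set τ : ENNReal := volume (ball p (1 / 2)) / volume Q with hτ
  have hτtop : τ ≠ ⊤ := ENNReal.div_ne_top (volume_ball_ne_top _ _) hQ0
  have hτ0 : 0 < τ.toReal := ENNReal.toReal_pos
    (ENNReal.div_pos (volume_ball_pos _ (by norm_num)).ne' hQtop).ne' hτtop
  have hτQ : ENNReal.ofReal τ.toReal * volume Q = volume (ball p (1 / 2)) := by
    rw [ENNReal.ofReal_toReal hτtop, hτ, ENNReal.div_mul_cancel hQ0 hQtop]
  obtain ⟨η, σ, hη, hσ, hU⟩ := hU (θ * τ.toReal) (mul_pos hθ.1 hτ0)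
  refine ⟨min η σ, lt_min hη hσ, ?_⟩
  rintro R ρ ε hR hρ hε hεR m M u hu ⟨K, hK⟩ hL huM hmeas x hx
  have hRρ : 0 < R ^ 2 * ρ := by positivity
  have hk : R ≤ (2 * k₁ + 2 * N + 1) * R := le_mul_of_one_le_left hR.le (by linarith)
  have hxM : u x ≤ M := huM x (ball_subset_ball hk hx)
  have hmin0 : 0 < min η σ := lt_min hη hσ
  rcases le_or_gt M m with hMm | hMm
  · have := mul_nonneg hmin0.le (sub_nonneg.2 hMm)
    linarith
  have ht : 0 < M - m := sub_pos.2 hMm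
  rcases lt_or_ge (σ * (M - m)) (8 * R ^ 2 * ρ) with hlt | hge
  · have := mul_le_mul_of_nonneg_right (min_le_right η σ) ht.le
    linarith
  have hr : 0 < 2 * R := by positivity
  set c : EuclideanSpace ℝ (Fin N) := -((2 * R) • p) with hc
  have hcp : c + (2 * R) • p = 0 := neg_add_cancel _
  have hpre : (fun y => c + (2 * R) • y) ⁻¹' ball 0 R = ball p (1 / 2) := by
    have := preimage_affine_ball c hr p (1 / 2)
    rwa [hcp, show 2 * R * (1 / 2) = R by ring] at this
  have hmaps : ∀ y ∈ ball (0 : EuclideanSpace ℝ (Fin N)) k₁,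
      c + (2 * R) • y ∈ ball 0 ((2 * k₁ + 2 * N + 1) * R) := by
    intro y hy
    have e : c + (2 * R) • y = (2 * R) • (y - p) := by rw [hc]; module
    rw [mem_ball_zero_iff] at hy ⊢
    rw [e, norm_smul, Real.norm_eq_abs, abs_of_pos hr]
    calc 2 * R * ‖y - p‖ ≤ 2 * R * (k₁ + N) := by
          gcongr
          exact (norm_sub_le y p).trans (add_le_add hy.le hpN)
      _ < _ := by linarith
  have hsup := (isSuper_const_sub_of_Lplus (M := M) (by linarith) hα0 hβ.1.le
    (by linarith : α + β = 1) hε hρ hu hK hL).rescale c hr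
  have key := hU (ε / (2 * R)) (2 * ε ^ 2 * ρ) (M - m) (by positivity)
    (by
      rw [div_le_iff₀ hr]
      linarith [mul_pos hε₁ hR])
    ht
    (by
      have e : 2 * ε ^ 2 * ρ = 8 * R ^ 2 * ρ * (ε / (2 * R)) ^ 2 := by field_simp; norm_num
      rw [e]
      gcongr)
    (fun y => M - u (c + (2 * R) • y)) (by fun_prop)
    ⟨|M| + K, fun y => (abs_sub _ _).trans (by gcongr; exact hK _)⟩
    (fun y hy => hsup y (hmaps y hy)) (fun y hy => sub_nonneg.2 (huM _ (hmaps y hy)))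
    (by
      rw [ENNReal.ofReal_mul hθ.1.le, mul_assoc, hτQ]
      rw [← volume_preimage_affine c hr (ball 0 R), ← volume_preimage_affine c hr
        (ball 0 R ∩ _), Set.preimage_inter, hpre, mul_left_comm] at hmeas
      have h2 : ENNReal.ofReal ((2 * R) ^ N) ≠ 0 := (ENNReal.ofReal_pos.2 (by positivity)).ne'
      refine ((ENNReal.mul_le_mul_iff_right h2 ENNReal.ofReal_ne_top).1 hmeas).trans
        (measure_mono fun y hy => ⟨?_, hroot hy.1⟩)
      exact sub_le_sub_left hy.2 M)
  have e : c + (2 * R) • (p + (2 * R)⁻¹ • x) = x := by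
    rw [smul_add, smul_smul, mul_inv_cancel₀ hr.ne', one_smul, ← add_assoc, hcp, zero_add]
  have hfin := key (p + (2 * R)⁻¹ • x) (hroot (by
    rw [← hpre, Set.mem_preimage, e]
    exact hx))
  rw [e] at hfin
  have := mul_le_mul_of_nonneg_right (min_le_left η σ) ht.le
  linarith
end

section
/- There exist constants C > 0, σ > 0 and ε₀ > 0, depending only on N, Λ, α, β, such that the following holds with κ = Λ√(2(σ+1)): if u is a bounded Borel measurable function on ℝ^N satisfying L_ε^- u ≤ 0 in B_7 and u ≥ 0 in ℝ^N, for some 0 < ε ≤ ε₀, then inf_{B_r(z)} u ≤ C r^{−2σ} inf_{B_1} u for every z ∈ B_2 and every r ∈ (κε, 1). -/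
open MeasureTheory Metric

/-- Second-order lower bound for the even part of `t ↦ (1 + t)⁻ⁿ`. -/
theorem inv_one_add_pow_add_inv_one_sub_pow_ge {t : ℝ} (h0 : 0 ≤ t) (h1 : t < 1) (n : ℕ) :
    2 + n * (n + 1) * t ^ 2 ≤ (1 + t)⁻¹ ^ n + (1 - t)⁻¹ ^ n ∧
      2 * n * t ≤ (1 - t)⁻¹ ^ n - (1 + t)⁻¹ ^ n := by
  induction n with
  | zero => norm_num
  | succ n ih =>
    obtain ⟨hS, hD⟩ := ih
    have hp : (1 + t)⁻¹ ^ n = (1 + t) * (1 + t)⁻¹ ^ (n + 1) := by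
      rw [pow_succ]; field_simp [show (1 + t) ≠ 0 by positivity]
    have hq : (1 - t)⁻¹ ^ n = (1 - t) * (1 - t)⁻¹ ^ (n + 1) := by
      rw [pow_succ]; field_simp [show (1 - t) ≠ 0 by linarith]
    rw [hp, hq] at hS hD
    set a := (1 + t)⁻¹ ^ (n + 1)
    set b := (1 - t)⁻¹ ^ (n + 1)
    have hn : (0 : ℝ) ≤ n := n.cast_nonneg
    have hsum : 2 ≤ a + b := by
      have h2 : 0 < 1 - t ^ 2 := by nlinarith
      have h3 : 2 + n * (n + 1) * t ^ 2 + t * (2 * n * t) ≤ (1 - t ^ 2) * (a + b) := by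
        nlinarith [mul_le_mul_of_nonneg_left hD h0]
      have h4 : 0 ≤ n * (n + 1) * t ^ 2 + t * (2 * n * t) := by positivity
      by_contra! h
      nlinarith [mul_lt_mul_of_pos_left h h2, sq_nonneg t]
    have hD' : 2 * (n + 1) * t ≤ b - a := by
      nlinarith [mul_le_mul_of_nonneg_left hsum h0]
    push_cast
    exact ⟨by nlinarith [mul_le_mul_of_nonneg_left hD' h0], hD'⟩

/-- Lower bound for second differences of `‖·‖ ^ (-2n)`, in terms of `A = ‖x‖ ^ 2`,
`s = ‖y‖ ^ 2` and `t = 2 ⟪x, y⟫`. -/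
theorem inv_pow_add_inv_pow_sub_ge {A s t : ℝ} (n : ℕ) (hA : 0 < A) (hs : 0 ≤ s)
    (hsA : 2 * (n + 1) * s ≤ A) (hp : 0 < A + s + t) (hq : 0 < A + s - t) :
    A⁻¹ ^ n * (-(2 * n * (s / A)) + n ^ 2 * (t / A) ^ 2 / 2) ≤
      (A + s + t)⁻¹ ^ n + (A + s - t)⁻¹ ^ n - 2 * A⁻¹ ^ n := by
  wlog ht : 0 ≤ t generalizing t
  · have := this (t := -t) (by linarith) (by linarith) (by linarith)
    rw [neg_div, neg_sq, sub_neg_eq_add, ← sub_eq_add_neg] at this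
    linarith
  have hn : (0 : ℝ) ≤ n := n.cast_nonneg
  have ha : 0 < A + s := by linarith
  have hl : 0 ≤ t / (A + s) := by positivity
  have hl1 : t / (A + s) < 1 := by rw [div_lt_one ha]; linarith
  have key := (inv_one_add_pow_add_inv_one_sub_pow_ge hl hl1 n).1
  have e1 : (A + s + t)⁻¹ = (A + s)⁻¹ * (1 + t / (A + s))⁻¹ := by
    rw [← mul_inv]; congr 1; field_simp
  have e2 : (A + s - t)⁻¹ = (A + s)⁻¹ * (1 - t / (A + s))⁻¹ := by
    rw [← mul_inv]; congr 1; field_simp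
  have e3 : (A + s)⁻¹ = A⁻¹ * (1 + s / A)⁻¹ := by
    rw [← mul_inv]; congr 1; field_simp
  have e4 : t / (A + s) = (t / A) * (1 + s / A)⁻¹ := by
    rw [div_eq_mul_inv, e3]; ring
  set h := s / A with hh
  have h0 : 0 ≤ h := by positivity
  have hle : 2 * (n + 1) * h ≤ 1 := by
    rw [hh, ← mul_div_assoc, div_le_one hA]; exact hsA
  have hh1 : h ≤ 1 := by nlinarith
  set g := (1 + h)⁻¹ with hg
  have hgh : 1 - h ≤ g := by
    rw [hg, le_inv_comm₀ (by nlinarith) (by linarith)]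
    · rw [inv_eq_one_div, le_div_iff₀ (by nlinarith)]; nlinarith
  have bern : ∀ k : ℕ, 1 - k * h ≤ g ^ k := fun k => by
    have := one_add_mul_le_pow (a := -h) (by linarith) k
    calc 1 - k * h = 1 + k * (-h) := by ring
      _ ≤ (1 + -h) ^ k := this
      _ ≤ g ^ k := pow_le_pow_left₀ (by linarith) (by linarith) k
  have b1 := bern n
  have b2 := bern (n + 2)
  push_cast at b2
  have b3 : (n : ℝ) / 2 ≤ (n + 1) * g ^ (n + 2) := by nlinarith
  rw [e1, e2, mul_pow, mul_pow, e3]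
  rw [e4] at key ⊢
  have hAn : 0 < A⁻¹ ^ n := by positivity
  have hgn : 0 ≤ g ^ n := by positivity
  have k2 := mul_le_mul_of_nonneg_left key hgn
  have k3 := mul_le_mul_of_nonneg_left b3 (show 0 ≤ n * (t / A) ^ 2 by positivity)
  rw [mul_pow]
  have : -(2 * n * h) + n ^ 2 * (t / A) ^ 2 / 2 ≤
      g ^ n * ((1 + t / A * g)⁻¹ ^ n + (1 - t / A * g)⁻¹ ^ n) - 2 := by
    have e5 : g ^ n * (2 + n * (n + 1) * (t / A * g) ^ 2) =
      2 * g ^ n + n * (t / A) ^ 2 * ((n + 1) * g ^ (n + 2)) := by ring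
    rw [e5] at k2
    linarith
  have := mul_le_mul_of_nonneg_left this hAn.le
  linarith

/-- A quantitative lower bound for the second moments of the unit ball. -/
theorem setIntegral_ball_inner_sq_ge {N : ℕ} (x : EuclideanSpace ℝ (Fin N)) :
    ‖x‖ ^ 2 / 16 * (1 / 4) ^ N * volume.real (ball (0 : EuclideanSpace ℝ (Fin N)) 1) ≤
      ∫ y in ball (0 : EuclideanSpace ℝ (Fin N)) 1, inner ℝ x y ^ 2 := by
  rcases eq_or_ne x 0 with rfl | hx
  · simp
  have hx' : 0 < ‖x‖ := norm_pos_iff.2 hx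
  set c : EuclideanSpace ℝ (Fin N) := (1 / (2 * ‖x‖)) • x with hc
  have hcn : ‖c‖ = 1 / 2 := by
    rw [hc, norm_smul, Real.norm_of_nonneg (by positivity)]; field_simp
  have hsub : ball c (1 / 4) ⊆ ball 0 1 := by
    apply ball_subset_ball'
    rw [dist_zero_right, hcn]; norm_num
  have hcont : Continuous fun y : EuclideanSpace ℝ (Fin N) => inner ℝ x y ^ 2 := by fun_prop
  have hint : IntegrableOn (fun y : EuclideanSpace ℝ (Fin N) => inner ℝ x y ^ 2) (ball 0 1) :=
    (hcont.continuousOn.integrableOn_compact (isCompact_closedBall 0 1)).mono_set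
      ball_subset_closedBall
  have hlow : ∀ y ∈ ball c (1 / 4), ‖x‖ ^ 2 / 16 ≤ inner ℝ x y ^ 2 := fun y hy => by
    have h1 : inner ℝ x y = ‖x‖ / 2 + inner ℝ x (y - c) := by
      rw [inner_sub_right, hc, inner_smul_right, real_inner_self_eq_norm_sq]
      field_simp; ring
    have h2 := abs_real_inner_le_norm x (y - c)
    rw [mem_ball, dist_eq_norm] at hy
    have h3 : |inner ℝ x (y - c)| ≤ ‖x‖ / 4 := h2.trans (by nlinarith)
    have h4 : ‖x‖ / 4 ≤ inner ℝ x y := by rw [h1]; linarith [(abs_le.1 h3).1]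
    nlinarith
  calc _ = ‖x‖ ^ 2 / 16 * volume.real (ball c (1 / 4)) := by
        rw [measureReal_def, measureReal_def, Measure.addHaar_ball_of_pos _ c (by norm_num),
          ENNReal.toReal_mul, ENNReal.toReal_ofReal (by positivity), finrank_euclideanSpace_fin]
        ring
    _ ≤ ∫ y in ball c (1 / 4), inner ℝ x y ^ 2 :=
        setIntegral_ge_of_const_le_real measurableSet_ball measure_ball_lt_top.ne hlow
          (hint.mono_set hsub)
    _ ≤ _ := setIntegral_mono_set hint (ae_of_all _ fun y => sq_nonneg _) hsub.eventuallyLE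

/-- Second differences of the fundamental-type function `‖·‖ ^ (-2n)`. -/
theorem ddiff_norm_sq_inv_pow_ge {N : ℕ} (n : ℕ) (hn : 1 ≤ n) {z x y : EuclideanSpace ℝ (Fin N)}
    (hx : x ≠ z) (hy : 2 * (n + 1) * ‖y‖ ^ 2 ≤ ‖x - z‖ ^ 2) :
    (‖x - z‖ ^ 2)⁻¹ ^ n * (2 * n / ‖x - z‖ ^ 2) *
        (-‖y‖ ^ 2 + n * inner ℝ (‖x - z‖⁻¹ • (x - z)) y ^ 2) ≤
      ddiff (fun w => (‖w - z‖ ^ 2)⁻¹ ^ n) x y := by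
  have hA : 0 < ‖x - z‖ := norm_pos_iff.2 (sub_ne_zero.2 hx)
  have hn' : (1 : ℝ) ≤ n := by exact_mod_cast hn
  have hyx : ‖y‖ < ‖x - z‖ := by
    by_contra! h
    nlinarith [norm_nonneg y, mul_nonneg (sub_nonneg.2 hn') (sq_nonneg ‖y‖)]
  have e1 : ‖x + y - z‖ ^ 2 = ‖x - z‖ ^ 2 + ‖y‖ ^ 2 + 2 * inner ℝ (x - z) y := by
    rw [show x + y - z = (x - z) + y by abel, norm_add_sq_real]; ring
  have e2 : ‖x - y - z‖ ^ 2 = ‖x - z‖ ^ 2 + ‖y‖ ^ 2 - 2 * inner ℝ (x - z) y := by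
    rw [show x - y - z = (x - z) - y by abel, norm_sub_sq_real]; ring
  have hI := abs_le.1 (abs_real_inner_le_norm (x - z) y)
  have key := inv_pow_add_inv_pow_sub_ge (A := ‖x - z‖ ^ 2) (s := ‖y‖ ^ 2)
    (t := 2 * inner ℝ (x - z) y) n (by positivity) (by positivity) hy
    (by nlinarith [hI.1, mul_self_pos.2 (sub_ne_zero.2 hyx.ne)])
    (by nlinarith [hI.2, mul_self_pos.2 (sub_ne_zero.2 hyx.ne)])
  simp only [ddiff]
  rw [e1, e2]
  refine le_trans (le_of_eq ?_) key
  rw [real_inner_smul_left]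
  field_simp

/-- A quadratic lower bound on second differences bounds `Lminus` from below. -/
theorem le_Lminus_of_le_ddiff {N : ℕ} {Λ α β ε G D b : ℝ} (hΛ : 1 ≤ Λ) (hα0 : 0 ≤ α)
    (hβ0 : 0 ≤ β) (hαβ : α + β = 1) (hε : 0 < ε) (hG : 0 ≤ G) (hb : 0 ≤ b)
    {u : EuclideanSpace ℝ (Fin N) → ℝ} (hu : Measurable u) {K : ℝ} (hK : ∀ x, |u x| ≤ K)
    {x e : EuclideanSpace ℝ (Fin N)} (he : ‖e‖ = 1)
    (h : ∀ y ∈ ball (0 : EuclideanSpace ℝ (Fin N)) Λ,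
      G * (-‖y‖ ^ 2 + b * inner ℝ e y ^ 2) - D ≤ ddiff u x (ε • y)) :
    G * (-(α * Λ ^ 2) - β + β * b * (1 / 16 * (1 / 4) ^ N)) - D ≤
      2 * ε ^ 2 * Lminus Λ α β ε u x := by
  have hinf : -(G * Λ ^ 2) - D ≤
      sInf ((fun z => ddiff u x (ε • z)) '' ball (0 : EuclideanSpace ℝ (Fin N)) Λ) := by
    apply le_csInf
    · exact (nonempty_ball.2 (by linarith)).image _
    · rintro _ ⟨y, hy, rfl⟩
      refine le_trans ?_ (h y hy)
      rw [mem_ball_zero_iff] at hy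
      have h1 : ‖y‖ ^ 2 ≤ Λ ^ 2 := pow_le_pow_left₀ (norm_nonneg y) hy.le 2
      have h2 : 0 ≤ b * inner ℝ e y ^ 2 := by positivity
      nlinarith [mul_le_mul_of_nonneg_left h1 hG, mul_nonneg hG h2]
  set V := volume.real (ball (0 : EuclideanSpace ℝ (Fin N)) 1) with hV
  have hVpos : 0 < V :=
    ENNReal.toReal_pos (measure_ball_pos _ _ one_pos).ne' measure_ball_lt_top.ne
  have hI := setIntegral_ball_inner_sq_ge e
  rw [he, ← hV] at hI
  have hcont : Continuous fun y : EuclideanSpace ℝ (Fin N) => inner ℝ e y ^ 2 := by fun_prop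
  have hint : IntegrableOn (fun y : EuclideanSpace ℝ (Fin N) => inner ℝ e y ^ 2) (ball 0 1) :=
    (hcont.continuousOn.integrableOn_compact (isCompact_closedBall 0 1)).mono_set
      ball_subset_closedBall
  have hintc : IntegrableOn (fun _ : EuclideanSpace ℝ (Fin N) => -G - D) (ball 0 1) :=
    integrableOn_const measure_ball_lt_top.ne
  have hintd : IntegrableOn (fun y => ddiff u x (ε • y)) (ball 0 1) := by
    refine Measure.integrableOn_of_bounded (M := 4 * K) measure_ball_lt_top.ne ?_ ?_
    · unfold ddiff
      exact Measurable.aestronglyMeasurable (by fun_prop)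
    · refine ae_of_all _ fun y => ?_
      have h1 := abs_le.1 (hK (x + ε • y))
      have h2 := abs_le.1 (hK (x - ε • y))
      have h3 := abs_le.1 (hK x)
      rw [Real.norm_eq_abs, abs_le]
      unfold ddiff
      constructor <;> linarith
  have havg : -G - D + G * b * (1 / 16 * (1 / 4) ^ N) ≤
      ⨍ y in ball (0 : EuclideanSpace ℝ (Fin N)) 1, ddiff u x (ε • y) := by
    rw [setAverage_eq, smul_eq_mul, ← hV, ← div_eq_inv_mul, le_div_iff₀ hVpos]
    have hmono : ∫ y in ball (0 : EuclideanSpace ℝ (Fin N)) 1,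
        ((-G - D) + G * b * inner ℝ e y ^ 2) ≤
        ∫ y in ball (0 : EuclideanSpace ℝ (Fin N)) 1, ddiff u x (ε • y) := by
      refine setIntegral_mono_on (hintc.add (hint.const_mul _)) hintd measurableSet_ball
        fun y hy => ?_
      refine le_trans ?_ (h y (ball_subset_ball hΛ hy))
      rw [mem_ball_zero_iff] at hy
      have h1 : ‖y‖ ^ 2 ≤ 1 := pow_le_one₀ (norm_nonneg y) hy.le
      nlinarith [mul_le_mul_of_nonneg_left h1 hG]
    rw [integral_add hintc (hint.const_mul _), integral_const_mul, setIntegral_const,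
      ← hV, smul_eq_mul] at hmono
    have := mul_le_mul_of_nonneg_left hI (mul_nonneg hG hb)
    nlinarith
  have hL : 2 * ε ^ 2 * Lminus Λ α β ε u x =
      α * sInf ((fun z => ddiff u x (ε • z)) '' ball (0 : EuclideanSpace ℝ (Fin N)) Λ)
      + β * ⨍ y in ball (0 : EuclideanSpace ℝ (Fin N)) 1, ddiff u x (ε • y) := by
    unfold Lminus
    field_simp
  rw [hL]
  have h1 := mul_le_mul_of_nonneg_left hinf hα0
  have h2 := mul_le_mul_of_nonneg_left havg hβ0
  have h3 : α * D + β * D = D := by rw [← add_mul, hαβ, one_mul]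
  linarith

/-- Comparison of a nonnegative supersolution with the barrier `‖· - z‖ ^ (-2n)`. -/
theorem barrier_le_of_Lminus_nonpos {N : ℕ} {Λ α β ε r m : ℝ} (hΛ : 1 ≤ Λ) (hα0 : 0 ≤ α)
    (hβ0 : 0 ≤ β) (hαβ : α + β = 1) (hε : 0 < ε) (hr : 0 < r) (hm : 0 < m) {n : ℕ} (hn : 1 ≤ n)
    (hnN : 1 + α * Λ ^ 2 + β ≤ β * n * (1 / 16 * (1 / 4) ^ N))
    (hεr : 2 * (n + 1) * (Λ * ε) ^ 2 ≤ r ^ 2)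
    {u : EuclideanSpace ℝ (Fin N) → ℝ} (hu : Measurable u) {K : ℝ} (hK : ∀ x, |u x| ≤ K)
    (hu0 : ∀ x, 0 ≤ u x) {z : EuclideanSpace ℝ (Fin N)}
    (hL : ∀ x ∈ ball z 4, Lminus Λ α β ε u x ≤ 0) (hmu : ∀ x ∈ ball z r, m ≤ u x)
    {x : EuclideanSpace ℝ (Fin N)} (hx4 : x ∈ ball z 4) (hxr : x ∉ ball z r) :
    m * (r ^ 2 / 4) ^ n * ((‖x - z‖ ^ 2)⁻¹ ^ n - 16⁻¹ ^ n) ≤ u x := by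
  have hn' : (1 : ℝ) ≤ n := by exact_mod_cast hn
  set c := m * (r ^ 2 / 4) ^ n with hc
  have hcpos : 0 < c := by positivity
  set φ : EuclideanSpace ℝ (Fin N) → ℝ := fun w => c * ((‖w - z‖ ^ 2)⁻¹ ^ n - 16⁻¹ ^ n) with hφ
  set S := ball z 4 \ ball z r with hS
  have hnear : ∀ w, r / 2 ≤ ‖w - z‖ → φ w ≤ m := fun w hw => by
    have h1 : (‖w - z‖ ^ 2)⁻¹ ≤ (r ^ 2 / 4)⁻¹ := by
      apply inv_anti₀ (by positivity)
      nlinarith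
    have h2 := pow_le_pow_left₀ (by positivity) h1 n
    calc φ w ≤ c * (‖w - z‖ ^ 2)⁻¹ ^ n := by
          apply mul_le_mul_of_nonneg_left _ hcpos.le
          have : (0 : ℝ) ≤ 16⁻¹ ^ n := by positivity
          linarith
      _ ≤ c * (r ^ 2 / 4)⁻¹ ^ n := mul_le_mul_of_nonneg_left h2 hcpos.le
      _ = m := by rw [hc, mul_assoc, ← mul_pow, mul_inv_cancel₀ (by positivity), one_pow, mul_one]
  have hfar : ∀ w, w ∉ ball z 4 → φ w ≤ 0 := fun w hw => by
    rw [mem_ball, dist_eq_norm, not_lt] at hw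
    have h1 : (‖w - z‖ ^ 2)⁻¹ ≤ 16⁻¹ := inv_anti₀ (by norm_num) (by nlinarith)
    have h2 := pow_le_pow_left₀ (by positivity) h1 n
    exact mul_nonpos_of_nonneg_of_nonpos hcpos.le (by linarith)
  set η := c * 16⁻¹ ^ n * (2 * n / 16) * ε ^ 2 with hη
  have hηpos : 0 < η := by positivity
  have step : ∀ M, 0 ≤ M → (∀ w ∈ S, φ w - u w ≤ M) → ∀ w ∈ S, φ w - u w ≤ M - η / 2 := by
    intro M hM0 hM w hw
    have hw4 := hw.1
    have hwr := hw.2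
    rw [mem_ball, dist_eq_norm] at hw4
    rw [mem_ball, dist_eq_norm, not_lt] at hwr
    have hwpos : 0 < ‖w - z‖ := hr.trans_le hwr
    have hwz : w ≠ z := by rintro rfl; simp at hwpos
    have hall : ∀ v, r / 2 ≤ ‖v - z‖ → φ v - u v ≤ M := fun v hv => by
      by_cases h4 : v ∈ ball z 4
      · by_cases hr' : v ∈ ball z r
        · linarith [hnear v hv, hmu v hr']
        · exact hM v ⟨h4, hr'⟩
      · linarith [hfar v h4, hu0 v]
    set G := c * ((‖w - z‖ ^ 2)⁻¹ ^ n * (2 * n / ‖w - z‖ ^ 2)) * ε ^ 2 with hG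
    have hGpos : 0 < G := by positivity
    have hηG : η ≤ G := by
      have h16 : ‖w - z‖ ^ 2 ≤ 16 := by nlinarith
      have : (16 : ℝ)⁻¹ ≤ (‖w - z‖ ^ 2)⁻¹ := inv_anti₀ (by positivity) h16
      rw [hη, hG, mul_assoc c]
      gcongr
    have hlow := le_Lminus_of_le_ddiff (Λ := Λ) (α := α) (β := β) (ε := ε) (G := G) (b := n)
      (D := 2 * (M - (φ w - u w))) (x := w) (e := ‖w - z‖⁻¹ • (w - z))
      hΛ hα0 hβ0 hαβ hε hGpos.le (by positivity) hu hK
      (by rw [norm_smul, norm_inv, norm_norm, inv_mul_cancel₀ hwpos.ne']) (by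
        intro y hy
        rw [mem_ball_zero_iff] at hy
        have hyn : ‖ε • y‖ = ε * ‖y‖ := by rw [norm_smul, Real.norm_of_nonneg hε.le]
        have hyΛ : ‖ε • y‖ ≤ Λ * ε := by rw [hyn]; nlinarith
        have hy2 : ‖ε • y‖ ^ 2 ≤ (Λ * ε) ^ 2 := pow_le_pow_left₀ (norm_nonneg _) hyΛ 2
        have hyr : 2 * (n + 1) * ‖ε • y‖ ^ 2 ≤ r ^ 2 :=
          (mul_le_mul_of_nonneg_left hy2 (by positivity)).trans hεr
        have hrw : r ^ 2 ≤ ‖w - z‖ ^ 2 := pow_le_pow_left₀ hr.le hwr 2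
        have hyhalf : ‖ε • y‖ ≤ r / 2 := by
          apply le_of_sq_le_sq _ (by positivity)
          nlinarith [sq_nonneg ‖ε • y‖]
        have hb := ddiff_norm_sq_inv_pow_ge n hn hwz (hyr.trans hrw)
        have hp : r / 2 ≤ ‖w + ε • y - z‖ := by
          have := norm_sub_le_norm_add (w - z) (ε • y)
          rw [show w + ε • y - z = (w - z) + ε • y by abel]
          linarith
        have hq : r / 2 ≤ ‖w - ε • y - z‖ := by
          have := norm_sub_norm_le (w - z) (ε • y)
          rw [show w - ε • y - z = (w - z) - ε • y by abel]
          linarith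
        have h1 := hall _ hp
        have h2 := hall _ hq
        have h3 : ddiff φ w (ε • y) = c * ddiff (fun v => (‖v - z‖ ^ 2)⁻¹ ^ n) w (ε • y) := by
          simp only [ddiff, hφ]; ring
        have h4 : G * (-‖y‖ ^ 2 + n * inner ℝ (‖w - z‖⁻¹ • (w - z)) y ^ 2) ≤
            ddiff φ w (ε • y) := by
          rw [h3]
          refine le_trans (le_of_eq ?_) (mul_le_mul_of_nonneg_left hb hcpos.le)
          rw [hyn, inner_smul_right, hG]
          ring
        simp only [ddiff] at h4 ⊢
        linarith)
    have hLw : 2 * ε ^ 2 * Lminus Λ α β ε u w ≤ 0 :=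
      mul_nonpos_of_nonneg_of_nonpos (by positivity) (hL w hw.1)
    have hG1 : G * 1 ≤ G * (-(α * Λ ^ 2) - β + β * n * (1 / 16 * (1 / 4) ^ N)) :=
      mul_le_mul_of_nonneg_left (by linarith) hGpos.le
    linarith
  change φ x ≤ u x
  by_contra! hlt
  have hxS : x ∈ S := ⟨hx4, hxr⟩
  have hbdd : BddAbove ((fun w => φ w - u w) '' S) := by
    refine ⟨m, ?_⟩
    rintro _ ⟨w, hw, rfl⟩
    have hwr := hw.2
    rw [mem_ball, dist_eq_norm, not_lt] at hwr
    have := hnear w (by linarith)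
    change φ w - u w ≤ m
    linarith [hu0 w]
  have hle : ∀ w ∈ S, φ w - u w ≤ sSup ((fun w => φ w - u w) '' S) := fun w hw =>
    le_csSup hbdd ⟨w, hw, rfl⟩
  have hM0 := hle x hxS
  have hstep := step _ (by linarith) hle
  have : sSup ((fun w => φ w - u w) '' S) ≤ sSup ((fun w => φ w - u w) '' S) - η / 2 := by
    apply csSup_le (Set.Nonempty.image _ ⟨x, hxS⟩)
    rintro _ ⟨w, hw, rfl⟩
    exact hstep w hw
  linarith

/-- There exist `C > 0`, `σ > 0` and `ε₀ > 0`, depending only on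
`N, Λ, α, β`, such that, with `κ = Λ√(2(σ+1))`: if `u` is bounded Borel measurable with
`L_ε^- u ≤ 0` in `B_7` and `u ≥ 0` in `ℝ^N`, for some `0 < ε ≤ ε₀`, then
`inf_{B_r(z)} u ≤ C r^{−2σ} inf_{B_1} u` for every `z ∈ B_2` and `r ∈ (κε, 1)`. -/
theorem infimum_comparison (N : ℕ) (hN : 1 ≤ N) (Λ α β : ℝ) (hΛ : 1 ≤ Λ)
    (hβ : β ∈ Set.Ioc (0 : ℝ) 1) (hα : α = 1 - β) :
    ∃ (C σ ε₀ : ℝ), 0 < C ∧ 0 < σ ∧ 0 < ε₀ ∧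
      ∀ ε : ℝ, 0 < ε → ε ≤ ε₀ →
        ∀ u : EuclideanSpace ℝ (Fin N) → ℝ,
          Measurable u → (∃ K, ∀ x, |u x| ≤ K) →
          (∀ x ∈ ball (0 : EuclideanSpace ℝ (Fin N)) 7, Lminus Λ α β ε u x ≤ 0) →
          (∀ x, 0 ≤ u x) →
          ∀ z ∈ ball (0 : EuclideanSpace ℝ (Fin N)) 2,
            ∀ r : ℝ, Λ * Real.sqrt (2 * (σ + 1)) * ε < r → r < 1 →
              sInf (u '' ball z r) ≤
                C * r ^ (-(2 * σ)) * sInf (u '' ball (0 : EuclideanSpace ℝ (Fin N)) 1) := by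
  obtain ⟨hβ0, hβ1⟩ := hβ
  have hα0 : 0 ≤ α := by linarith
  have hδ : 0 < β * (1 / 16 * (1 / 4 : ℝ) ^ N) := by positivity
  obtain ⟨n₀, hn₀⟩ := exists_nat_ge ((1 + α * Λ ^ 2 + β) / (β * (1 / 16 * (1 / 4 : ℝ) ^ N)))
  obtain ⟨n, hn, hnN⟩ : ∃ n : ℕ, 1 ≤ n ∧
      1 + α * Λ ^ 2 + β ≤ β * n * (1 / 16 * (1 / 4) ^ N) := by
    refine ⟨n₀ + 1, by omega, ?_⟩
    rw [div_le_iff₀ hδ] at hn₀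
    push_cast
    linarith
  have hn' : (1 : ℝ) ≤ n := by exact_mod_cast hn
  set d : ℝ := 9⁻¹ ^ n - 16⁻¹ ^ n with hd
  have hd0 : 0 < d := sub_pos.2 (pow_lt_pow_left₀ (by norm_num) (by norm_num) (by omega))
  have hd1 : d ≤ 1 := by
    have h1 : (9⁻¹ : ℝ) ^ n ≤ 1 := pow_le_one₀ (by norm_num) (by norm_num)
    have h2 : (0 : ℝ) ≤ 16⁻¹ ^ n := by positivity
    linarith
  refine ⟨4 ^ n / d, n, 1, by positivity, by positivity, one_pos, ?_⟩
  rintro ε hε - u hu ⟨K, hK⟩ hL hu0 z hz r hr hr1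
  have hr0 : 0 < r := lt_of_le_of_lt (by positivity) hr
  have hεr : 2 * (n + 1) * (Λ * ε) ^ 2 ≤ r ^ 2 := by
    have h1 := pow_le_pow_left₀ (by positivity) hr.le 2
    rw [mul_pow, mul_pow, Real.sq_sqrt (by positivity)] at h1
    linarith
  have hpow : r ^ (-(2 * (n : ℝ))) = ((r ^ 2) ^ n)⁻¹ := by
    rw [Real.rpow_neg hr0.le, ← pow_mul]
    congr 1
    exact_mod_cast Real.rpow_natCast r (2 * n)
  rw [hpow]
  set m := sInf (u '' ball z r) with hm
  have hmu : ∀ x ∈ ball z r, m ≤ u x := fun x hx =>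
    csInf_le ⟨0, by rintro _ ⟨y, -, rfl⟩; exact hu0 y⟩ ⟨x, hx, rfl⟩
  have hrn : 0 < (r ^ 2) ^ n := by positivity
  have hCpos : 0 < 4 ^ n / d * ((r ^ 2) ^ n)⁻¹ := by positivity
  have hz2 : ‖z‖ < 2 := mem_ball_zero_iff.1 hz
  rw [← div_le_iff₀' hCpos]
  apply le_csInf ((nonempty_ball.2 one_pos).image _)
  rintro _ ⟨x, hx, rfl⟩
  rw [mem_ball_zero_iff] at hx
  rcases le_or_gt m 0 with hm0 | hm0
  · exact (div_nonpos_of_nonpos_of_nonneg hm0 hCpos.le).trans (hu0 x)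
  by_cases hxr : x ∈ ball z r
  · refine (div_le_self hm0.le ?_).trans (hmu x hxr)
    have h1 : (1 : ℝ) ≤ 4 ^ n / d := by
      rw [le_div_iff₀ hd0, one_mul]
      exact hd1.trans (one_le_pow₀ (by norm_num))
    have h2 : 1 ≤ ((r ^ 2) ^ n)⁻¹ :=
      (one_le_inv₀ hrn).2 (pow_le_one₀ (by positivity) (by nlinarith))
    exact one_le_mul_of_one_le_of_one_le h1 h2
  have hxz : ‖x - z‖ < 3 := (norm_sub_le x z).trans_lt (by linarith)
  have hb := barrier_le_of_Lminus_nonpos hΛ hα0 hβ0.le (by rw [hα]; ring) hε hr0 hm0 hn hnN hεr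
    hu hK hu0 (z := z) (fun y hy => hL y (ball_subset_ball' (by
      rw [dist_zero_right]; linarith) hy)) hmu (x := x)
    (by rw [mem_ball, dist_eq_norm]; linarith) hxr
  refine le_trans ?_ hb
  have hxpos : 0 < ‖x - z‖ := by
    rw [mem_ball, dist_eq_norm, not_lt] at hxr
    linarith
  have h9 : (9 : ℝ)⁻¹ ^ n ≤ (‖x - z‖ ^ 2)⁻¹ ^ n :=
    pow_le_pow_left₀ (by norm_num) (inv_anti₀ (by positivity) (by nlinarith)) n
  calc m / (4 ^ n / d * ((r ^ 2) ^ n)⁻¹) = m * (r ^ 2 / 4) ^ n * d := by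
        rw [div_pow]; field_simp
    _ ≤ _ := mul_le_mul_of_nonneg_left (by linarith) (by positivity)
end
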